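/- arXiv:math/0208140 — 2 statements merged into one kernel-verified Lean document; each statement's English description precedes it below -/
import Mathlib

section
/- The assignment S(u) ↦ S + q u⁻¹ S̄ together with (s_{ii′}^{(0)})^{−1} ↦ s_{ii′}^{−1} — that is, s_ij^{(0)} ↦ s_ij, s_ij^{(1)} ↦ q s̄_ij, and s_ij^{(r)} ↦ 0 for r ≥ 2 — defines an algebra homomorphism (the evaluation homomorphism) from the twisted q-Yangian Y^tw_q(sp_2n) onto the twisted quantized enveloping algebra U^tw_q(sp_2n). Here S̄ = T̄ G Tᵗ, whose entries lie in U^tw_q(sp_2n): for odd i, s̄_ii = −q⁻² s_ii, s̄_{i′i′} = −q⁻² s_{i′i′}, s̄_{i′i} = −q⁻¹ s_{ii′}, s̄_{ii′} = −q⁻¹ s_{i′i} + (1−q⁻²) s_{ii′}, and s̄_ij = −q⁻¹ s_ji for i < j with j ≠ i′. -/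
noncomputable section

open scoped TensorProduct

abbrev FF : Type := RatFunc ℂ

def qq : FF := RatFunc.X

/-! Constant R-matrices acting in `ℂ^N ⊗ ℂ^N`, written as matrices indexed by pairs. -/

def Rc (F : Type) [Field F] (q : F) (N : ℕ) :
    Matrix (Fin N × Fin N) (Fin N × Fin N) F := Matrix.of fun p r =>
  (if p = r then (if p.1 = p.2 then q else 1) else 0)
  + (if p.1 = r.2 ∧ p.2 = r.1 ∧ p.1 < p.2 then q - q⁻¹ else 0)

/-- `R` transposed in the first tensor factor. -/
def Rct (F : Type) [Field F] (q : F) (N : ℕ) :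
    Matrix (Fin N × Fin N) (Fin N × Fin N) F :=
  Matrix.of fun p r => Rc F q N (r.1, p.2) (p.1, r.2)

def Rtil (F : Type) [Field F] (q : F) (N : ℕ) :
    Matrix (Fin N × Fin N) (Fin N × Fin N) F := Matrix.of fun p r =>
  (if p = r then (if p.1 = p.2 then q⁻¹ else 1) else 0)
  + (if p.1 = r.2 ∧ p.2 = r.1 ∧ p.2 < p.1 then q⁻¹ - q else 0)

def Rtilt (F : Type) [Field F] (q : F) (N : ℕ) :
    Matrix (Fin N × Fin N) (Fin N × Fin N) F :=
  Matrix.of fun p r => Rtil F q N (r.1, p.2) (p.1, r.2)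

/-- `S ↦ S ⊗ 1` (action in the first copy of `End ℂ^N`). -/
def amp1 {A : Type} [Ring A] {N : ℕ} (M : Matrix (Fin N) (Fin N) A) :
    Matrix (Fin N × Fin N) (Fin N × Fin N) A :=
  Matrix.of fun p r => if p.2 = r.2 then M p.1 r.1 else 0

/-- `S ↦ 1 ⊗ S` (action in the second copy of `End ℂ^N`). -/
def amp2 {A : Type} [Ring A] {N : ℕ} (M : Matrix (Fin N) (Fin N) A) :
    Matrix (Fin N × Fin N) (Fin N × Fin N) A :=
  Matrix.of fun p r => if p.1 = r.1 then M p.2 r.2 else 0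

/-- A scalar matrix viewed as a matrix over an `F`-algebra `A`. -/
def liftF (F : Type) [Field F] {A : Type} [Ring A] [Algebra F A] {m : Type}
    (M : Matrix m m F) : Matrix m m A := M.map (algebraMap F A)

/-- Left hand side `R S₁ Rᵗ S₂` of the reflection equation. -/
def reflLHS (F : Type) [Field F] (q : F) {N : ℕ} {A : Type} [Ring A] [Algebra F A]
    (S : Matrix (Fin N) (Fin N) A) : Matrix (Fin N × Fin N) (Fin N × Fin N) A :=
  liftF F (Rc F q N) * amp1 S * liftF F (Rct F q N) * amp2 S

/-- Right hand side `S₂ Rᵗ S₁ R` of the reflection equation. -/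
def reflRHS (F : Type) [Field F] (q : F) {N : ℕ} {A : Type} [Ring A] [Algebra F A]
    (S : Matrix (Fin N) (Fin N) A) : Matrix (Fin N × Fin N) (Fin N × Fin N) A :=
  amp2 S * liftF F (Rct F q N) * amp1 S * liftF F (Rc F q N)

/-- The list of index pairs `(i,j)` in lexicographic order. -/
def lexPairs (N : ℕ) : List (Fin N × Fin N) :=
  (List.finRange N).flatMap fun i => (List.finRange N).map fun j => (i, j)

/-! The generic matrix of generators. -/

def Sfree (F : Type) [Field F] (N : ℕ) :
    Matrix (Fin N) (Fin N) (FreeAlgebra F (Fin N × Fin N)) :=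
  Matrix.of fun i j => FreeAlgebra.ι F (i, j)

/-- Defining relations: only the reflection equation. -/
inductive Rel0 (F : Type) [Field F] (q : F) (N : ℕ) :
    FreeAlgebra F (Fin N × Fin N) → FreeAlgebra F (Fin N × Fin N) → Prop
  | refl (p r : Fin N × Fin N) :
      Rel0 F q N (reflLHS F q (Sfree F N) p r) (reflRHS F q (Sfree F N) p r)

/-- The algebra with generators `s_ij` and the reflection equation as defining relations. -/
abbrev Alg0 (F : Type) [Field F] (q : F) (N : ℕ) := RingQuot (Rel0 F q N)

def s0 (F : Type) [Field F] (q : F) (N : ℕ) (i j : Fin N) : Alg0 F q N :=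
  RingQuot.mkAlgHom F (Rel0 F q N) (FreeAlgebra.ι F (i, j))

/-- Defining relations of the presented algebra `𝒮` of the orthogonal case. -/
inductive OSRel (F : Type) [Field F] (q : F) (N : ℕ) :
    FreeAlgebra F (Fin N × Fin N) → FreeAlgebra F (Fin N × Fin N) → Prop
  | tri (i j : Fin N) (h : i < j) : OSRel F q N (FreeAlgebra.ι F (i, j)) 0
  | diag (i : Fin N) : OSRel F q N (FreeAlgebra.ι F (i, i)) 1
  | refl (p r : Fin N × Fin N) :
      OSRel F q N (reflLHS F q (Sfree F N) p r) (reflRHS F q (Sfree F N) p r)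

abbrev AlgOS (F : Type) [Field F] (q : F) (N : ℕ) := RingQuot (OSRel F q N)

def sOS (F : Type) [Field F] (q : F) (N : ℕ) (i j : Fin N) : AlgOS F q N :=
  RingQuot.mkAlgHom F (OSRel F q N) (FreeAlgebra.ι F (i, j))

/-! The quantized enveloping algebra `U_q(gl_N)` by its RTT presentation. -/

abbrev GlGen (N : ℕ) := (Fin N × Fin N) ⊕ (Fin N × Fin N)

def Tfree (F : Type) [Field F] (N : ℕ) :
    Matrix (Fin N) (Fin N) (FreeAlgebra F (GlGen N)) :=
  Matrix.of fun i j => FreeAlgebra.ι F (Sum.inl (i, j))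

def Tbfree (F : Type) [Field F] (N : ℕ) :
    Matrix (Fin N) (Fin N) (FreeAlgebra F (GlGen N)) :=
  Matrix.of fun i j => FreeAlgebra.ι F (Sum.inr (i, j))

/-- `R X₁ Y₂` -/
def rttLHS (F : Type) [Field F] (q : F) {N : ℕ} {A : Type} [Ring A] [Algebra F A]
    (X Y : Matrix (Fin N) (Fin N) A) : Matrix (Fin N × Fin N) (Fin N × Fin N) A :=
  liftF F (Rc F q N) * amp1 X * amp2 Y

/-- `Y₂ X₁ R` -/
def rttRHS (F : Type) [Field F] (q : F) {N : ℕ} {A : Type} [Ring A] [Algebra F A]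
    (X Y : Matrix (Fin N) (Fin N) A) : Matrix (Fin N × Fin N) (Fin N × Fin N) A :=
  amp2 Y * amp1 X * liftF F (Rc F q N)

inductive GlRel (F : Type) [Field F] (q : F) (N : ℕ) :
    FreeAlgebra F (GlGen N) → FreeAlgebra F (GlGen N) → Prop
  | t_zero (i j : Fin N) (h : i < j) : GlRel F q N (Tfree F N i j) 0
  | tb_zero (i j : Fin N) (h : j < i) : GlRel F q N (Tbfree F N i j) 0
  | t_tb (i : Fin N) : GlRel F q N (Tfree F N i i * Tbfree F N i i) 1
  | tb_t (i : Fin N) : GlRel F q N (Tbfree F N i i * Tfree F N i i) 1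
  | rtt (p r : Fin N × Fin N) :
      GlRel F q N (rttLHS F q (Tfree F N) (Tfree F N) p r)
        (rttRHS F q (Tfree F N) (Tfree F N) p r)
  | rtbtb (p r : Fin N × Fin N) :
      GlRel F q N (rttLHS F q (Tbfree F N) (Tbfree F N) p r)
        (rttRHS F q (Tbfree F N) (Tbfree F N) p r)
  | rtbt (p r : Fin N × Fin N) :
      GlRel F q N (rttLHS F q (Tbfree F N) (Tfree F N) p r)
        (rttRHS F q (Tbfree F N) (Tfree F N) p r)

/-- The quantized enveloping algebra `U_q(gl_N)`. -/
abbrev UqGl (F : Type) [Field F] (q : F) (N : ℕ) := RingQuot (GlRel F q N)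

def tE (F : Type) [Field F] (q : F) (N : ℕ) (i j : Fin N) : UqGl F q N :=
  RingQuot.mkAlgHom F (GlRel F q N) (FreeAlgebra.ι F (Sum.inl (i, j)))

def tbE (F : Type) [Field F] (q : F) (N : ℕ) (i j : Fin N) : UqGl F q N :=
  RingQuot.mkAlgHom F (GlRel F q N) (FreeAlgebra.ι F (Sum.inr (i, j)))

/-- The entries `s_ij = Σ_a t_ia t̄_ja` of `S = T T̄ᵗ`. -/
def sE (F : Type) [Field F] (q : F) (N : ℕ) (i j : Fin N) : UqGl F q N :=
  ∑ a : Fin N, tE F q N i a * tbE F q N j a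

/-- The twisted quantized enveloping algebra `U^tw_q(o_N)` as a subalgebra of `U_q(gl_N)`. -/
def UtwO (F : Type) [Field F] (q : F) (N : ℕ) : Subalgebra F (UqGl F q N) :=
  Algebra.adjoin F {x | ∃ i j, x = sE F q N i j}

/-! Symplectic (finite) case. -/

/-- `2k` as an element of `Fin (2n)` (the 0-based version of the odd index `2k-1`). -/
def fe (n : ℕ) (k : Fin n) : Fin (2 * n) := ⟨2 * k.val, by have := k.isLt; omega⟩

/-- `2k+1` as an element of `Fin (2n)` (the 0-based version of the even index `2k`). -/
def fo (n : ℕ) (k : Fin n) : Fin (2 * n) := ⟨2 * k.val + 1, by have := k.isLt; omega⟩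

/-- The entries `s_ij` of `S = T G T̄ᵗ` in `U_q(gl_2n)`. -/
def sSp (F : Type) [Field F] (q : F) (n : ℕ) (i j : Fin (2 * n)) : UqGl F q (2 * n) :=
  algebraMap F _ q * ∑ a : Fin n, tE F q (2 * n) i (fe n a) * tbE F q (2 * n) j (fo n a)
    - ∑ a : Fin n, tE F q (2 * n) i (fo n a) * tbE F q (2 * n) j (fe n a)

abbrev SpGen (n : ℕ) := (Fin (2 * n) × Fin (2 * n)) ⊕ Fin n

def SpFreeS (F : Type) [Field F] (n : ℕ) :
    Matrix (Fin (2 * n)) (Fin (2 * n)) (FreeAlgebra F (SpGen n)) :=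
  Matrix.of fun i j => FreeAlgebra.ι F (Sum.inl (i, j))

/-- Defining relations of the presented algebra `𝒮` of the symplectic case. -/
inductive SpRel (F : Type) [Field F] (q : F) (n : ℕ) :
    FreeAlgebra F (SpGen n) → FreeAlgebra F (SpGen n) → Prop
  | tri (i j : Fin (2 * n)) (h : i < j) (h' : ¬(i.val % 2 = 0 ∧ j.val = i.val + 1)) :
      SpRel F q n (FreeAlgebra.ι F (Sum.inl (i, j))) 0
  | quad (k : Fin n) :
      SpRel F q n
        (FreeAlgebra.ι F (Sum.inl (fo n k, fo n k)) * FreeAlgebra.ι F (Sum.inl (fe n k, fe n k)))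
        (algebraMap F _ (q ^ 2) *
            (FreeAlgebra.ι F (Sum.inl (fo n k, fe n k)) *
              FreeAlgebra.ι F (Sum.inl (fe n k, fo n k)))
          + algebraMap F _ (q ^ 3))
  | invR (k : Fin n) :
      SpRel F q n
        (FreeAlgebra.ι F (Sum.inl (fe n k, fo n k)) * FreeAlgebra.ι F (Sum.inr k)) 1
  | invL (k : Fin n) :
      SpRel F q n
        (FreeAlgebra.ι F (Sum.inr k) * FreeAlgebra.ι F (Sum.inl (fe n k, fo n k))) 1
  | refl (p r : Fin (2 * n) × Fin (2 * n)) :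
      SpRel F q n (reflLHS F q (SpFreeS F n) p r) (reflRHS F q (SpFreeS F n) p r)

abbrev AlgSp (F : Type) [Field F] (q : F) (n : ℕ) := RingQuot (SpRel F q n)

def sSpP (F : Type) [Field F] (q : F) (n : ℕ) (i j : Fin (2 * n)) : AlgSp F q n :=
  RingQuot.mkAlgHom F (SpRel F q n) (FreeAlgebra.ι F (Sum.inl (i, j)))

def sInvP (F : Type) [Field F] (q : F) (n : ℕ) (k : Fin n) : AlgSp F q n :=
  RingQuot.mkAlgHom F (SpRel F q n) (FreeAlgebra.ι F (Sum.inr k))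

/-- row `i = 2k` of the symplectic ordered monomial: positions `(i,0),…,(i,2k)`. -/
def rowA (n : ℕ) (k : Fin n) : List (Fin (2 * n) × Fin (2 * n)) :=
  ((List.finRange (2 * n)).filter fun j => j.val ≤ 2 * k.val).map fun j => (fe n k, j)

/-- row `i' = 2k+1` of the symplectic ordered monomial: positions `(i',0),…,(i',2k-1)`. -/
def rowB (n : ℕ) (k : Fin n) : List (Fin (2 * n) × Fin (2 * n)) :=
  ((List.finRange (2 * n)).filter fun j => j.val + 2 ≤ 2 * k.val + 1).map fun j => (fo n k, j)

/-- The ordered monomials of the symplectic case, with an arbitrary integer exponent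
on each `s_{i i'}` and nonnegative exponents elsewhere. -/
def monomSp {A : Type} [Ring A] (n : ℕ) (s : Fin (2 * n) × Fin (2 * n) → A) (sI : Fin n → A)
    (kN : Fin (2 * n) × Fin (2 * n) → ℕ) (kZ : Fin n → ℤ) : A :=
  ((List.finRange n).map fun k =>
    ((rowA n k).map fun p => s p ^ kN p).prod *
      (if 0 ≤ kZ k then s (fe n k, fo n k) ^ (kZ k).toNat else sI k ^ (-(kZ k)).toNat) *
      s (fo n k, fo n k) ^ kN (fo n k, fo n k) *
      ((rowB n k).map fun p => s p ^ kN p).prod).prod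

/-! Affine (twisted q-Yangian) machinery.  Series are treated coefficientwise. -/

/-- `z1 S r` is the coefficient matrix (in the first copy) of a series indexed by
nonnegative integers, extended by zero to `ℤ`. -/
def z1 {A : Type} [Ring A] {N : ℕ} (S : ℕ → Matrix (Fin N) (Fin N) A) (r : ℤ) :
    Matrix (Fin N × Fin N) (Fin N × Fin N) A :=
  if 0 ≤ r then amp1 (S r.toNat) else 0

def z2 {A : Type} [Ring A] {N : ℕ} (S : ℕ → Matrix (Fin N) (Fin N) A) (r : ℤ) :
    Matrix (Fin N × Fin N) (Fin N × Fin N) A :=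
  if 0 ≤ r then amp2 (S r.toNat) else 0

/-- Coefficient of `u^a v^b` in `R(u,v) S₁(u) Rᵗ(u⁻¹,v) S₂(v)`,
using `R(u,v) = u R̃ - v R` and `Rᵗ(u⁻¹,v) = u⁻¹ R̃ᵗ - v Rᵗ`. -/
def affLHS (F : Type) [Field F] (q : F) {N : ℕ} {A : Type} [Ring A] [Algebra F A]
    (S : ℕ → Matrix (Fin N) (Fin N) A) (a b : ℤ) :
    Matrix (Fin N × Fin N) (Fin N × Fin N) A :=
  liftF F (Rtil F q N) * z1 S (-a) * liftF F (Rtilt F q N) * z2 S (-b)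
    - liftF F (Rtil F q N) * z1 S (1 - a) * liftF F (Rct F q N) * z2 S (1 - b)
    - liftF F (Rc F q N) * z1 S (-1 - a) * liftF F (Rtilt F q N) * z2 S (1 - b)
    + liftF F (Rc F q N) * z1 S (-a) * liftF F (Rct F q N) * z2 S (2 - b)

/-- Coefficient of `u^a v^b` in `S₂(v) Rᵗ(u⁻¹,v) S₁(u) R(u,v)`. -/
def affRHS (F : Type) [Field F] (q : F) {N : ℕ} {A : Type} [Ring A] [Algebra F A]
    (S : ℕ → Matrix (Fin N) (Fin N) A) (a b : ℤ) :
    Matrix (Fin N × Fin N) (Fin N × Fin N) A :=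
  z2 S (-b) * liftF F (Rtilt F q N) * z1 S (-a) * liftF F (Rtil F q N)
    - z2 S (1 - b) * liftF F (Rtilt F q N) * z1 S (-1 - a) * liftF F (Rc F q N)
    - z2 S (1 - b) * liftF F (Rct F q N) * z1 S (1 - a) * liftF F (Rtil F q N)
    + z2 S (2 - b) * liftF F (Rct F q N) * z1 S (-a) * liftF F (Rc F q N)

def SfreeA (F : Type) [Field F] (N : ℕ) (r : ℕ) :
    Matrix (Fin N) (Fin N) (FreeAlgebra F (ℕ × Fin N × Fin N)) :=
  Matrix.of fun i j => FreeAlgebra.ι F (r, i, j)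

/-- Defining relations: only the affine reflection equation (coefficientwise). -/
inductive Rel9 (F : Type) [Field F] (q : F) (N : ℕ) :
    FreeAlgebra F (ℕ × Fin N × Fin N) → FreeAlgebra F (ℕ × Fin N × Fin N) → Prop
  | refl (a b : ℤ) (p r : Fin N × Fin N) :
      Rel9 F q N (affLHS F q (SfreeA F N) a b p r) (affRHS F q (SfreeA F N) a b p r)

abbrev Alg9 (F : Type) [Field F] (q : F) (N : ℕ) := RingQuot (Rel9 F q N)

def s9 (F : Type) [Field F] (q : F) (N : ℕ) (r : ℕ) (i j : Fin N) : Alg9 F q N :=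
  RingQuot.mkAlgHom F (Rel9 F q N) (FreeAlgebra.ι F (r, i, j))

/-- Defining relations of the presented twisted q-Yangian (orthogonal case). -/
inductive AORel (F : Type) [Field F] (q : F) (N : ℕ) :
    FreeAlgebra F (ℕ × Fin N × Fin N) → FreeAlgebra F (ℕ × Fin N × Fin N) → Prop
  | tri (i j : Fin N) (h : i < j) : AORel F q N (FreeAlgebra.ι F (0, i, j)) 0
  | diag (i : Fin N) : AORel F q N (FreeAlgebra.ι F (0, i, i)) 1
  | refl (a b : ℤ) (p r : Fin N × Fin N) :
      AORel F q N (affLHS F q (SfreeA F N) a b p r) (affRHS F q (SfreeA F N) a b p r)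

abbrev AlgAO (F : Type) [Field F] (q : F) (N : ℕ) := RingQuot (AORel F q N)

def sAO (F : Type) [Field F] (q : F) (N : ℕ) (r : ℕ) (i j : Fin N) : AlgAO F q N :=
  RingQuot.mkAlgHom F (AORel F q N) (FreeAlgebra.ι F (r, i, j))

/-- Lexicographic (non-strict) comparison of triples. -/
def tripLe (x y : ℕ × ℕ × ℕ) : Prop :=
  x.1 < y.1 ∨ (x.1 = y.1 ∧ (x.2.1 < y.2.1 ∨ (x.2.1 = y.2.1 ∧ x.2.2 ≤ y.2.2)))

/-- A list of generator indices `(r,i,j)` is ordered if it is weakly increasing with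
respect to the lexicographic order on `(r,i,j)`. -/
def sortedGens {N : ℕ} (l : List (ℕ × Fin N × Fin N)) : Prop :=
  l.Chain' fun x y => tripLe (x.1, x.2.1.val, x.2.2.val) (y.1, y.2.1.val, y.2.2.val)

/-! The quantum affine algebra `U_q(ĝl_N)` by its RTT presentation, coefficientwise. -/

abbrev AffGen (N : ℕ) := (ℕ × Fin N × Fin N) ⊕ (ℕ × Fin N × Fin N)

def TfA (F : Type) [Field F] (N : ℕ) (r : ℕ) :
    Matrix (Fin N) (Fin N) (FreeAlgebra F (AffGen N)) :=
  Matrix.of fun i j => FreeAlgebra.ι F (Sum.inl (r, i, j))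

def TbfA (F : Type) [Field F] (N : ℕ) (r : ℕ) :
    Matrix (Fin N) (Fin N) (FreeAlgebra F (AffGen N)) :=
  Matrix.of fun i j => FreeAlgebra.ι F (Sum.inr (r, i, j))

/-- Coefficient of `u^a v^b` in `R(u,v) X₁ Y₂` with prescribed coefficient extractions. -/
def affRttL (F : Type) [Field F] (q : F) {N : ℕ} {A : Type} [Ring A] [Algebra F A]
    (X Y : ℕ → Matrix (Fin N) (Fin N) A) (a b a' b' : ℤ) :
    Matrix (Fin N × Fin N) (Fin N × Fin N) A :=
  liftF F (Rtil F q N) * z1 X a * z2 Y b - liftF F (Rc F q N) * z1 X a' * z2 Y b'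

def affRttR (F : Type) [Field F] (q : F) {N : ℕ} {A : Type} [Ring A] [Algebra F A]
    (X Y : ℕ → Matrix (Fin N) (Fin N) A) (a b a' b' : ℤ) :
    Matrix (Fin N × Fin N) (Fin N × Fin N) A :=
  z2 Y b * z1 X a * liftF F (Rtil F q N) - z2 Y b' * z1 X a' * liftF F (Rc F q N)

inductive AffGlRel (F : Type) [Field F] (q : F) (N : ℕ) :
    FreeAlgebra F (AffGen N) → FreeAlgebra F (AffGen N) → Prop
  | t0_tri (i j : Fin N) (h : i < j) : AffGlRel F q N (TfA F N 0 i j) 0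
  | tb0_tri (i j : Fin N) (h : j < i) : AffGlRel F q N (TbfA F N 0 i j) 0
  | t_tb (i : Fin N) : AffGlRel F q N (TfA F N 0 i i * TbfA F N 0 i i) 1
  | tb_t (i : Fin N) : AffGlRel F q N (TbfA F N 0 i i * TfA F N 0 i i) 1
  | rtt (a b : ℤ) (p r : Fin N × Fin N) :
      AffGlRel F q N
        (affRttL F q (TfA F N) (TfA F N) (1 - a) (-b) (-a) (1 - b) p r)
        (affRttR F q (TfA F N) (TfA F N) (1 - a) (-b) (-a) (1 - b) p r)
  | rtbtb (a b : ℤ) (p r : Fin N × Fin N) :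
      AffGlRel F q N
        (affRttL F q (TbfA F N) (TbfA F N) (a - 1) b a (b - 1) p r)
        (affRttR F q (TbfA F N) (TbfA F N) (a - 1) b a (b - 1) p r)
  | rtbt (a b : ℤ) (p r : Fin N × Fin N) :
      AffGlRel F q N
        (affRttL F q (TbfA F N) (TfA F N) (a - 1) (-b) a (1 - b) p r)
        (affRttR F q (TbfA F N) (TfA F N) (a - 1) (-b) a (1 - b) p r)

/-- The quantum affine algebra `U_q(ĝl_N)`. -/
abbrev UqAff (F : Type) [Field F] (q : F) (N : ℕ) := RingQuot (AffGlRel F q N)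

def tA (F : Type) [Field F] (q : F) (N : ℕ) (r : ℕ) (i j : Fin N) : UqAff F q N :=
  RingQuot.mkAlgHom F (AffGlRel F q N) (FreeAlgebra.ι F (Sum.inl (r, i, j)))

def tbA (F : Type) [Field F] (q : F) (N : ℕ) (r : ℕ) (i j : Fin N) : UqAff F q N :=
  RingQuot.mkAlgHom F (AffGlRel F q N) (FreeAlgebra.ι F (Sum.inr (r, i, j)))

/-- Coefficient of `u^{-r}` in `s_ij(u) = Σ_a t_ia(u) t̄_ja(u⁻¹)`. -/
def Scoef (F : Type) [Field F] (q : F) (N : ℕ) (r : ℕ) (i j : Fin N) : UqAff F q N :=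
  ∑ a : Fin N, ∑ p ∈ Finset.range (r + 1), tA F q N p i a * tbA F q N (r - p) j a

/-- The twisted q-Yangian `Y^tw_q(o_N)` as a subalgebra of `U_q(ĝl_N)`. -/
def YtwO (F : Type) [Field F] (q : F) (N : ℕ) : Subalgebra F (UqAff F q N) :=
  Algebra.adjoin F {x | ∃ r i j, x = Scoef F q N r i j}

/-- Coefficient of `u^{-r}` in `s_ij(u)`, the `(i,j)` entry of `S(u) = T(u) G T̄(u⁻¹)ᵗ`
in the symplectic case. -/
def ScoefSp (F : Type) [Field F] (q : F) (n : ℕ) (r : ℕ) (i j : Fin (2 * n)) :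
    UqAff F q (2 * n) :=
  ∑ a : Fin n, ∑ p ∈ Finset.range (r + 1),
    (algebraMap F _ q * (tA F q (2 * n) p i (fe n a) * tbA F q (2 * n) (r - p) j (fo n a))
      - tA F q (2 * n) p i (fo n a) * tbA F q (2 * n) (r - p) j (fe n a))

/-- The twisted q-Yangian `Y^tw_q(sp_2n)` as a subalgebra of `U_q(ĝl_2n)`,
with a prescribed family of inverses of `s^{(0)}_{ii'}`. -/
def YtwSp (F : Type) [Field F] (q : F) (n : ℕ) (inv : Fin n → UqAff F q (2 * n)) :
    Subalgebra F (UqAff F q (2 * n)) :=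
  Algebra.adjoin F ({x | ∃ r i j, x = ScoefSp F q n r i j} ∪ Set.range inv)

abbrev ASpGen (n : ℕ) := (ℕ × Fin (2 * n) × Fin (2 * n)) ⊕ Fin n

def SfreeASp (F : Type) [Field F] (n : ℕ) (r : ℕ) :
    Matrix (Fin (2 * n)) (Fin (2 * n)) (FreeAlgebra F (ASpGen n)) :=
  Matrix.of fun i j => FreeAlgebra.ι F (Sum.inl (r, i, j))

/-- Defining relations of the presented twisted q-Yangian (symplectic case). -/
inductive ASpRel (F : Type) [Field F] (q : F) (n : ℕ) :
    FreeAlgebra F (ASpGen n) → FreeAlgebra F (ASpGen n) → Prop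
  | tri (i j : Fin (2 * n)) (h : i < j) (h' : ¬(i.val % 2 = 0 ∧ j.val = i.val + 1)) :
      ASpRel F q n (FreeAlgebra.ι F (Sum.inl (0, i, j))) 0
  | quad (k : Fin n) :
      ASpRel F q n
        (FreeAlgebra.ι F (Sum.inl (0, fo n k, fo n k)) *
          FreeAlgebra.ι F (Sum.inl (0, fe n k, fe n k)))
        (algebraMap F _ (q ^ 2) *
            (FreeAlgebra.ι F (Sum.inl (0, fo n k, fe n k)) *
              FreeAlgebra.ι F (Sum.inl (0, fe n k, fo n k)))
          + algebraMap F _ (q ^ 3))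
  | invR (k : Fin n) :
      ASpRel F q n
        (FreeAlgebra.ι F (Sum.inl (0, fe n k, fo n k)) * FreeAlgebra.ι F (Sum.inr k)) 1
  | invL (k : Fin n) :
      ASpRel F q n
        (FreeAlgebra.ι F (Sum.inr k) * FreeAlgebra.ι F (Sum.inl (0, fe n k, fo n k))) 1
  | refl (a b : ℤ) (p r : Fin (2 * n) × Fin (2 * n)) :
      ASpRel F q n (affLHS F q (SfreeASp F n) a b p r) (affRHS F q (SfreeASp F n) a b p r)

abbrev AlgASp (F : Type) [Field F] (q : F) (n : ℕ) := RingQuot (ASpRel F q n)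

def sASp (F : Type) [Field F] (q : F) (n : ℕ) (r : ℕ) (i j : Fin (2 * n)) : AlgASp F q n :=
  RingQuot.mkAlgHom F (ASpRel F q n) (FreeAlgebra.ι F (Sum.inl (r, i, j)))

def sInvASp (F : Type) [Field F] (q : F) (n : ℕ) (k : Fin n) : AlgASp F q n :=
  RingQuot.mkAlgHom F (ASpRel F q n) (FreeAlgebra.ι F (Sum.inr k))

/-! q-antisymmetrizer and Sklyanin/quantum determinant machinery. -/

/-- The trigonometric R-matrix `R(u,v)`. -/
def Rtrig (F : Type) [Field F] (q : F) (N : ℕ) (u v : F) :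
    Matrix (Fin N × Fin N) (Fin N × Fin N) F := Matrix.of fun p r =>
  (if p = r then (if p.1 = p.2 then q⁻¹ * u - q * v else u - v) else 0)
  + (if p.1 = r.2 ∧ p.2 = r.1 ∧ p.1 ≠ p.2 then
      (q⁻¹ - q) * (if p.2 < p.1 then u else v) else 0)

/-- An operator on `ℂ^N ⊗ ℂ^N` acting in the `i`-th and `j`-th factors of `(ℂ^N)^{⊗ r}`. -/
def big2 (F : Type) [Field F] {N r : ℕ} (i j : Fin r)
    (M : Matrix (Fin N × Fin N) (Fin N × Fin N) F) :
    Matrix (Fin r → Fin N) (Fin r → Fin N) F :=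
  Matrix.of fun f g =>
    if ∀ k, k ≠ i → k ≠ j → f k = g k then M (f i, f j) (g i, g j) else 0

/-- The list of the pairs `(i,j)`, `i < j`, in lexicographic order. -/
def pairsLex (r : ℕ) : List (Fin r × Fin r) :=
  (List.finRange r).flatMap fun i =>
    ((List.finRange r).filter fun j => i < j).map fun j => (i, j)

/-- The number of inversions (the Coxeter length) of a permutation. -/
def invCount {r : ℕ} (σ : Equiv.Perm (Fin r)) : ℕ :=
  (Finset.univ.filter fun p : Fin r × Fin r => p.1 < p.2 ∧ σ p.2 < σ p.1).card

/-- The q-permutation operator `P^q` on `ℂ^N ⊗ ℂ^N`. -/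
def PqSmall (F : Type) [Field F] (q : F) (N : ℕ) :
    Matrix (Fin N × Fin N) (Fin N × Fin N) F := Matrix.of fun p r =>
  if r.1 = p.2 ∧ r.2 = p.1 then (if p.1 = p.2 then 1 else if p.2 < p.1 then q else q⁻¹)
  else 0

/-- The hypothesis that `Pq` is the extension of the q-permutation operators along
reduced decompositions: `P^q_{σ s_i} = P^q_σ P^q_{s_i}` whenever the length grows. -/
def PqExt (F : Type) [Field F] (q : F) (N r : ℕ)
    (Pq : Equiv.Perm (Fin r) → Matrix (Fin r → Fin N) (Fin r → Fin N) F) : Prop :=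
  Pq 1 = 1 ∧
    ∀ (σ : Equiv.Perm (Fin r)) (i : ℕ) (h : i + 1 < r),
      invCount (σ * Equiv.swap ⟨i, Nat.lt_of_succ_lt h⟩ ⟨i + 1, h⟩) = invCount σ + 1 →
        Pq (σ * Equiv.swap ⟨i, Nat.lt_of_succ_lt h⟩ ⟨i + 1, h⟩) =
          Pq σ * big2 F ⟨i, Nat.lt_of_succ_lt h⟩ ⟨i + 1, h⟩ (PqSmall F q N)

/-- The q-antisymmetrizer `A^q_r = Σ_σ sgn(σ) P^q_σ`. -/
def AqM (F : Type) [Field F] {N r : ℕ}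
    (Pq : Equiv.Perm (Fin r) → Matrix (Fin r → Fin N) (Fin r → Fin N) F) :
    Matrix (Fin r → Fin N) (Fin r → Fin N) F :=
  ∑ σ : Equiv.Perm (Fin r), ((Equiv.Perm.sign σ : ℤ) : F) • Pq σ

/-- A matrix acting in the `k`-th factor of `(ℂ^N)^{⊗ N}`, with entries in `A`. -/
def ampAt {A : Type} [Ring A] {N : ℕ} (k : Fin N) (M : Matrix (Fin N) (Fin N) A) :
    Matrix (Fin N → Fin N) (Fin N → Fin N) A :=
  Matrix.of fun f g => if ∀ l, l ≠ k → f l = g l then M (f k) (g k) else 0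

/-- A scalar two-site operator viewed over `A`, acting at sites `i`, `j`. -/
def big2A (F : Type) [Field F] {A : Type} [Ring A] [Algebra F A] {N : ℕ} (i j : Fin N)
    (M : Matrix (Fin N × Fin N) (Fin N × Fin N) F) :
    Matrix (Fin N → Fin N) (Fin N → Fin N) A :=
  (big2 F i j M).map (algebraMap F A)

/-- Coefficient of `u^m` in a product of formal series, each of which is supported in
degrees `≤ 1`; the series are given by their coefficient functions `ℤ → M`. -/
def seriesProdCoeff {M : Type} [Ring M] : List (ℤ → M) → ℤ → M
  | [], m => if m = 0 then 1 else 0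
  | c :: t, m => ∑ k ∈ Finset.Icc (m - t.length) 1, c k * seriesProdCoeff t (m - k)

/-! Series factors entering the Sklyanin determinant. -/

/-- The matrix `S^{(r)}` of the coefficients of `S(u)` (orthogonal case). -/
def SmatA (F : Type) [Field F] (q : F) (N : ℕ) (r : ℕ) :
    Matrix (Fin N) (Fin N) (UqAff F q N) :=
  Matrix.of fun i j => Scoef F q N r i j

/-- The series `S_k(q^{-2k+2} u)` acting at site `k` (0-based `k`), coefficientwise. -/
def SfacO (F : Type) [Field F] (q : F) (N : ℕ) (k : Fin N) (m : ℤ) :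
    Matrix (Fin N → Fin N) (Fin N → Fin N) (UqAff F q N) :=
  if m ≤ 0 then q ^ (2 * (k.val : ℤ) * (-m)) • ampAt k (SmatA F q N (-m).toNat) else 0

/-- The series `R_{ij}ᵗ((q^{-2i+2}u)⁻¹, q^{-2j+2}u)` (0-based `i`, `j`), coefficientwise. -/
def RtfacO (F : Type) [Field F] (q : F) (N : ℕ) (i j : Fin N) (m : ℤ) :
    Matrix (Fin N → Fin N) (Fin N → Fin N) (UqAff F q N) :=
  if m = -1 then q ^ (2 * (i.val : ℤ)) • big2A F i j (Rtilt F q N)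
  else if m = 1 then (-(q ^ (-2 * (j.val : ℤ)))) • big2A F i j (Rct F q N)
  else 0

/-- The ordered list of factors `S₁(u) R₁₂ᵗ ⋯ R₁Nᵗ S₂(q⁻²u) ⋯ S_N(q^{-2N+2}u)`. -/
def sdetFacsO (F : Type) [Field F] (q : F) (N : ℕ) :
    List (ℤ → Matrix (Fin N → Fin N) (Fin N → Fin N) (UqAff F q N)) :=
  (List.finRange N).flatMap fun i =>
    SfacO F q N i :: (((List.finRange N).filter fun j => i < j).map fun j => RtfacO F q N i j)

/-- The matrix `S^{(r)}` of the coefficients of `S(u)` (symplectic case). -/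
def SmatASp (F : Type) [Field F] (q : F) (n : ℕ) (r : ℕ) :
    Matrix (Fin (2 * n)) (Fin (2 * n)) (UqAff F q (2 * n)) :=
  Matrix.of fun i j => ScoefSp F q n r i j

def SfacSp (F : Type) [Field F] (q : F) (n : ℕ) (k : Fin (2 * n)) (m : ℤ) :
    Matrix (Fin (2 * n) → Fin (2 * n)) (Fin (2 * n) → Fin (2 * n)) (UqAff F q (2 * n)) :=
  if m ≤ 0 then q ^ (2 * (k.val : ℤ) * (-m)) • ampAt k (SmatASp F q n (-m).toNat) else 0

def sdetFacsSp (F : Type) [Field F] (q : F) (n : ℕ) :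
    List (ℤ → Matrix (Fin (2 * n) → Fin (2 * n)) (Fin (2 * n) → Fin (2 * n))
      (UqAff F q (2 * n))) :=
  (List.finRange (2 * n)).flatMap fun i =>
    SfacSp F q n i ::
      (((List.finRange (2 * n)).filter fun j => i < j).map fun j => RtfacO F q (2 * n) i j)

/-- Coefficientwise quantum determinant `qdet T(u)`:
the coefficient of `u^m` (nonzero only for `m ≤ 0`). -/
def qdetTc (F : Type) [Field F] (q : F) (N : ℕ) (m : ℤ) : UqAff F q N :=
  if m ≤ 0 then
    ∑ σ : Equiv.Perm (Fin N), ∑ rv ∈ Finset.Nat.antidiagonalTuple N (-m).toNat,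
      (((-q)⁻¹ ^ invCount σ) * ∏ k : Fin N, q ^ (2 * (k.val : ℤ) * (rv k : ℤ))) •
        ((List.finRange N).map fun k => tA F q N (rv k) (σ k) k).prod
  else 0

/-- Coefficientwise quantum determinant `qdet T̄(q^{2N-2} u⁻¹)`:
the coefficient of `u^m` (nonzero only for `m ≤ 0`). -/
def qdetTbc (F : Type) [Field F] (q : F) (N : ℕ) (m : ℤ) : UqAff F q N :=
  if m ≤ 0 then
    ∑ σ : Equiv.Perm (Fin N), ∑ rv ∈ Finset.Nat.antidiagonalTuple N (-m).toNat,
      (((-q)⁻¹ ^ invCount σ) *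
          ∏ k : Fin N, q ^ ((2 * (N : ℤ) - 2 - 2 * (k.val : ℤ)) * (rv k : ℤ))) •
        ((List.finRange N).map fun k => tbA F q N (rv k) (σ k) k).prod
  else 0

/-- The linear factor `q^{2i-2}u⁻¹ - q^{-2j+2}u` of `γ_N(u)` (0-based `i`, `j`),
viewed as an `A`-valued series. -/
def gamFac (F : Type) [Field F] (q : F) (N : ℕ) (p : Fin N × Fin N) (m : ℤ) : UqAff F q N :=
  if m = -1 then algebraMap F _ (q ^ (2 * (p.1.val : ℤ)))
  else if m = 1 then algebraMap F _ (-(q ^ (-2 * (p.2.val : ℤ)))) else 0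

/-- The list of series whose product is `γ_N(u) qdet T(u) qdet T̄(q^{2N-2}u⁻¹)`
in the orthogonal case. -/
def rhsO (F : Type) [Field F] (q : F) (N : ℕ) : List (ℤ → UqAff F q N) :=
  ((pairsLex N).map fun p => gamFac F q N p) ++ [qdetTc F q N, qdetTbc F q N]

/-- The entries of `S̄ = T̄ G Tᵗ`, expressed inside `U^tw_q(sp_2n)`:
`s̄_ii = -q⁻² s_ii`, `s̄_{ii'} = -q⁻¹ s_{i'i} + (1-q⁻²) s_{ii'}`, and
`s̄_ij = -q⁻¹ s_ji` for all remaining entries. -/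
def sbarSpP (n : ℕ) (i j : Fin (2 * n)) : AlgSp FF qq n :=
  if i = j then algebraMap FF _ (-(qq⁻¹ ^ 2)) * sSpP FF qq n i i
  else if i.val % 2 = 0 ∧ j.val = i.val + 1 then
    algebraMap FF _ (-qq⁻¹) * sSpP FF qq n j i
      + algebraMap FF _ (1 - qq⁻¹ ^ 2) * sSpP FF qq n i j
  else algebraMap FF _ (-qq⁻¹) * sSpP FF qq n j i

/-! Hecke operators on arrays indexed by pairs. -/

section Hecke

variable {F : Type} [Field F] {B : Type} [AddCommGroup B] [Module F B] {N : ℕ}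

/-- The operator `P R` on arrays indexed by pairs, where `R` is the constant R-matrix. -/
def heckeOp (q : F) (N : ℕ) (B : Type) [AddCommGroup B] [Module F B] :
    (Fin N → Fin N → B) →ₗ[F] (Fin N → Fin N → B) where
  toFun x i j := if i = j then q • x i j else x j i + if j < i then (q - q⁻¹) • x i j else 0
  map_add' x y := by
    ext i j
    simp only [Pi.add_apply]
    split_ifs <;> module
  map_smul' c x := by
    ext i j
    simp only [Pi.smul_apply, RingHom.id_apply]
    split_ifs <;> module

theorem heckeOp_apply (q : F) (x : Fin N → Fin N → B) (i j : Fin N) :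
    heckeOp q N B x i j =
      if i = j then q • x i j else x j i + if j < i then (q - q⁻¹) • x i j else 0 := rfl

/-- The map induced on families by a linear map. -/
def familyMap {V : Type} [AddCommGroup V] [Module F V] (N : ℕ) (f : V →ₗ[F] V) :
    (Fin N → V) →ₗ[F] (Fin N → V) where
  toFun x i := f (x i)
  map_add' x y := by ext i; simp
  map_smul' c x := by ext i; simp

theorem familyMap_apply {V : Type} [AddCommGroup V] [Module F V] (f : V →ₗ[F] V)
    (x : Fin N → V) (i : Fin N) : familyMap N f x i = f (x i) := rfl

theorem heckeOp_heckeOp {q : F} (hq : q ≠ 0) (x : Fin N → Fin N → B) :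
    heckeOp q N B (heckeOp q N B x) = x + (q - q⁻¹) • heckeOp q N B x := by
  ext i j
  simp only [heckeOp_apply, Pi.add_apply, Pi.smul_apply]
  rcases lt_trichotomy i j with h | rfl | h
  · simp [h.ne, h.ne', h, h.not_gt]
  · simp only [if_true, smul_smul]
    rw [show q * q = 1 + (q - q⁻¹) * q by field_simp; ring, add_smul, one_smul]
  · simp [h.ne, h.ne', h, h.not_gt]

theorem heckeOp_braid {q : F} (hq : q ≠ 0) (x : Fin N → Fin N → Fin N → B) :
    heckeOp q N _ (familyMap N (heckeOp q N B) (heckeOp q N _ x)) =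
      familyMap N (heckeOp q N B) (heckeOp q N _ (familyMap N (heckeOp q N B) x)) := by
  ext i j k
  have ite_apply' : ∀ (P : Prop) [Decidable P] (f g : Fin N → B) (m : Fin N),
      (if P then f else g) m = if P then f m else g m := fun P _ f g m => by split_ifs <;> rfl
  have hl : q * q = 1 + (q - q⁻¹) * q := by field_simp; ring
  simp only [heckeOp_apply, familyMap_apply, Pi.add_apply, Pi.smul_apply, ite_apply',
    Pi.zero_apply]
  generalize q - q⁻¹ = l at *
  rcases lt_trichotomy i j with h | h | h <;> rcases lt_trichotomy j k with h' | h' | h' <;>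
    rcases lt_trichotomy i k with h'' | h'' | h'' <;>
    first
    | (exfalso; omega)
    | (subst_vars
       simp only [*, ne_of_lt, ne_of_gt, not_lt_of_gt, lt_irrefl, if_true, if_false]
       try match_scalars <;>
         first
         | ring1
         | linear_combination l * hl
         | linear_combination -l * hl)

theorem heckeOp_comm {V : Type} [AddCommGroup V] [Module F V] (q : F) (f : V →ₗ[F] V)
    (x : Fin N → Fin N → V) :
    heckeOp q N V (familyMap N (familyMap N f) x) =
      familyMap N (familyMap N f) (heckeOp q N V x) := by
  ext i j
  simp only [heckeOp_apply, familyMap_apply]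
  split_ifs <;> simp

end Hecke

/-- The constant reflection equation implies the affine one, coefficientwise, in a
representation of the Hecke algebra of type `A₃`: if `T₁T₂w = T₃T₂w` and `W` is the family of
coefficients of `(1 - u⁻¹T₁⁻¹)(1 - v⁻¹T₃⁻¹)w`, then `(uT₁⁻¹ - vT₁)(u⁻¹T₂⁻¹ - vT₂)W(u,v)` equals
`(uT₃⁻¹ - vT₃)(u⁻¹T₂⁻¹ - vT₂)W(v,u)`. Here `Uᵢ` is the inverse of `Tᵢ`. -/
theorem hecke_baxterization {F M : Type} [Field F] [AddCommGroup M] [Module F M] (l : F)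
    (T₁ T₂ T₃ U₁ U₂ U₃ : M →ₗ[F] M)
    (hU₁ : ∀ x, U₁ x = T₁ x - l • x) (hU₂ : ∀ x, U₂ x = T₂ x - l • x)
    (hU₃ : ∀ x, U₃ x = T₃ x - l • x)
    (hT₁ : ∀ x, T₁ (T₁ x) = x + l • T₁ x) (hT₂ : ∀ x, T₂ (T₂ x) = x + l • T₂ x)
    (hT₃ : ∀ x, T₃ (T₃ x) = x + l • T₃ x)
    (h12 : ∀ x, T₁ (T₂ (T₁ x)) = T₂ (T₁ (T₂ x)))
    (h23 : ∀ x, T₂ (T₃ (T₂ x)) = T₃ (T₂ (T₃ x)))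
    (h13 : ∀ x, T₁ (T₃ x) = T₃ (T₁ x))
    (w : M) (hw : T₁ (T₂ w) = T₃ (T₂ w)) (W : ℤ → ℤ → M) (W00 : W 0 0 = w)
    (W10 : W 1 0 = -U₁ w) (W01 : W 0 1 = -U₃ w) (W11 : W 1 1 = -U₁ (W 0 1))
    (W_left : ∀ r s : ℤ, r < 0 ∨ 2 ≤ r → W r s = 0)
    (W_right : ∀ r s : ℤ, s < 0 ∨ 2 ≤ s → W r s = 0) (a b : ℤ) :
    U₁ (U₂ (W (-a) (-b))) - U₁ (T₂ (W (1 - a) (1 - b)))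
      - T₁ (U₂ (W (-1 - a) (1 - b))) + T₁ (T₂ (W (-a) (2 - b))) =
      U₃ (U₂ (W (-b) (-a))) - T₃ (U₂ (W (1 - b) (-1 - a)))
      - U₃ (T₂ (W (1 - b) (1 - a))) + T₃ (T₂ (W (2 - b) (-a))) := by
  have TU₁ : ∀ x, T₁ (U₁ x) = x := fun x => by rw [hU₁, map_sub, map_smul, hT₁]; module
  have UT₁ : ∀ x, U₁ (T₁ x) = x := fun x => by rw [hU₁, hT₁]; module
  have TU₂ : ∀ x, T₂ (U₂ x) = x := fun x => by rw [hU₂, map_sub, map_smul, hT₂]; module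
  have UT₂ : ∀ x, U₂ (T₂ x) = x := fun x => by rw [hU₂, hT₂]; module
  have TU₃ : ∀ x, T₃ (U₃ x) = x := fun x => by rw [hU₃, map_sub, map_smul, hT₃]; module
  have UT₃ : ∀ x, U₃ (T₃ x) = x := fun x => by rw [hU₃, hT₃]; module
  have c13 : ∀ x, U₁ (U₃ x) = U₃ (U₁ x) := fun x => by
    simp only [hU₁, hU₃, map_sub, map_smul, h13]; module
  have cU1T3 : ∀ x, U₁ (T₃ x) = T₃ (U₁ x) := fun x => by
    simp only [hU₁, map_sub, map_smul, h13]
  have cT1U3 : ∀ x, T₁ (U₃ x) = U₃ (T₁ x) := fun x => by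
    simp only [hU₃, map_sub, map_smul, h13]
  have braid₁ : ∀ x, T₁ (T₂ (U₁ x)) = U₂ (T₁ (T₂ x)) := fun x => by
    rw [← UT₂ (T₁ (T₂ (U₁ x))), ← h12, TU₁]
  have braid₃ : ∀ x, T₃ (T₂ (U₃ x)) = U₂ (T₃ (T₂ x)) := fun x => by
    rw [← UT₂ (T₃ (T₂ (U₃ x))), h23, TU₃]
  have braid₁' : ∀ x, T₁ (U₂ (U₁ x)) = U₂ (U₁ (T₂ x)) := fun x => by
    rw [← UT₂ (T₁ (U₂ (U₁ x))), ← UT₁ (T₂ (T₁ (U₂ (U₁ x)))), h12, TU₂, TU₁]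
  have braid₃' : ∀ x, T₃ (U₂ (U₃ x)) = U₂ (U₃ (T₂ x)) := fun x => by
    rw [← UT₂ (T₃ (U₂ (U₃ x))), ← UT₃ (T₂ (T₃ (U₂ (U₃ x)))), ← h23, TU₂, TU₃]
  have diff : ∀ {x}, T₁ x = T₃ x → U₁ x = U₃ x := fun h => by rw [hU₁, hU₃, h]
  have hA : U₁ (T₂ w) = U₃ (T₂ w) := diff hw
  have hB : T₁ (T₂ (U₁ w)) = T₃ (T₂ (U₃ w)) := by rw [braid₁, braid₃, hw]
  have hC : U₁ (T₂ (U₃ w)) = U₃ (T₂ (U₁ w)) := by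
    rw [← UT₃ (U₁ (T₂ (U₃ w))), ← cU1T3, ← hB, UT₁]
  have hD : U₁ (U₂ (U₃ w)) = U₃ (U₂ (U₁ w)) := by
    simp only [hU₂, map_sub, map_smul, hC, c13]
  have hE : T₁ (U₂ (U₁ w)) = T₃ (U₂ (U₃ w)) := by rw [braid₁', braid₃', hA]
  have hG : T₁ (U₂ (U₁ (U₃ w))) = T₃ (U₂ (U₁ (U₃ w))) := by
    rw [braid₁', hC, c13, braid₃']
  have hH : U₁ (T₂ (U₁ w)) - T₁ (T₂ (U₃ w)) = U₃ (T₂ (U₃ w)) - T₃ (T₂ (U₁ w)) := by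
    have h := hC
    rw [hU₁ (T₂ _), hU₃ (T₂ _)] at h
    rw [hU₁ (T₂ _), hU₃ (T₂ _), hB]
    linear_combination (norm := module) -h
  have hK : U₁ (U₂ (U₁ w)) - T₁ (U₂ (U₃ w)) = U₃ (U₂ (U₃ w)) - T₃ (U₂ (U₁ w)) := by
    have h := hD
    rw [hU₁ (U₂ _), hU₃ (U₂ _)] at h
    rw [hU₁ (U₂ _), hU₃ (U₂ _), hE]
    linear_combination (norm := module) -h
  have hL : T₁ (U₂ w) - T₁ (T₂ (U₁ (U₃ w))) = T₃ (U₂ w) - T₃ (T₂ (U₁ (U₃ w))) := by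
    have h₁ : T₂ (U₁ (U₃ w)) = U₂ (U₁ (U₃ w)) + l • U₁ (U₃ w) := by rw [hU₂]; module
    have h₂ : T₁ (U₁ (U₃ w)) = T₃ w - l • w := by rw [TU₁, hU₃]
    have h₃ : T₃ (U₁ (U₃ w)) = T₁ w - l • w := by rw [c13, TU₃, hU₁]
    rw [h₁, hU₂ w]
    simp only [map_add, map_sub, map_smul, h₂, h₃, hG, hw]
    module
  have hM : U₁ (U₂ w) - U₁ (T₂ (U₁ (U₃ w))) = U₃ (U₂ w) - U₃ (T₂ (U₁ (U₃ w))) := by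
    rw [← map_sub, ← map_sub] at hL ⊢
    exact diff hL
  have hN := diff hG
  rw [W01, map_neg, neg_neg] at W11
  have ha : a < -2 ∨ a = -2 ∨ a = -1 ∨ a = 0 ∨ a = 1 ∨ 1 < a := by omega
  have hb : b < -1 ∨ b = -1 ∨ b = 0 ∨ b = 1 ∨ b = 2 ∨ 2 < b := by omega
  rcases ha with ha | rfl | rfl | rfl | rfl | ha <;>
    rcases hb with hb | rfl | rfl | rfl | rfl | hb <;>
    simp (disch := omega) only [W_left, W_right, map_zero] <;> norm_num <;>
    simp (disch := omega) only [W00, W01, W10, W11, map_neg] <;>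
    first
    | with_reducible assumption
    | linear_combination (norm := module) -hC
    | linear_combination (norm := module) -hD
    | linear_combination (norm := module) -hB
    | linear_combination (norm := module) -hE
    | linear_combination (norm := module) hH
    | linear_combination (norm := module) -hK
    | linear_combination (norm := module) -hL

/-! Entries of the two sides of the reflection equation in terms of the Hecke operators. -/

section Entries

variable {F : Type} [Field F] {A : Type} [Ring A] [Algebra F A] {N : ℕ}

/-- The operator `P Q` on arrays indexed by pairs. -/
def arrayOp (Q : Matrix (Fin N × Fin N) (Fin N × Fin N) F) {B : Type} [AddCommGroup B]
    [Module F B] (x : Fin N → Fin N → B) (i j : Fin N) : B :=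
  ∑ a, ∑ b, Q (j, i) (a, b) • x a b

theorem arrayOp_Rc (q : F) {B : Type} [AddCommGroup B] [Module F B] (x : Fin N → Fin N → B) :
    arrayOp (Rc F q N) x = heckeOp q N B x := by
  ext i j
  have h : ∀ a b : Fin N, Rc F q N (j, i) (a, b) • x a b =
      (if j = a then if i = b then (if j = i then q else 1) • x a b else 0 else 0) +
      (if i = a then if j = b then (if j < i then q - q⁻¹ else 0) • x a b else 0 else 0) := by
    intro a b
    simp only [Rc, Matrix.of_apply, Prod.mk.injEq, add_smul]
    congr 1
    · by_cases h₁ : j = a <;> by_cases h₂ : i = b <;> simp [h₁, h₂]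
    · by_cases h₁ : j = b <;> by_cases h₂ : i = a <;> simp [h₁, h₂]
  simp only [arrayOp, h, Finset.sum_add_distrib, Finset.sum_ite_irrel, Finset.sum_const_zero,
    Finset.sum_ite_eq, Finset.mem_univ, if_true, heckeOp_apply]
  rcases lt_trichotomy i j with h | rfl | h
  · simp [h.ne, h.ne', h.not_gt]
  · simp
  · simp [h.ne', h.ne, h]

theorem arrayOp_Rtil (q : F) {B : Type} [AddCommGroup B] [Module F B]
    (x : Fin N → Fin N → B) :
    arrayOp (Rtil F q N) x = heckeOp q N B x - (q - q⁻¹) • x := by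
  ext i j
  have h : ∀ a b : Fin N, Rtil F q N (j, i) (a, b) • x a b =
      (if j = a then if i = b then (if j = i then q⁻¹ else 1) • x a b else 0 else 0) +
      (if i = a then if j = b then (if i < j then q⁻¹ - q else 0) • x a b else 0 else 0) := by
    intro a b
    simp only [Rtil, Matrix.of_apply, Prod.mk.injEq, add_smul]
    congr 1
    · by_cases h₁ : j = a <;> by_cases h₂ : i = b <;> simp [h₁, h₂]
    · by_cases h₁ : j = b <;> by_cases h₂ : i = a <;> simp [h₁, h₂]
  simp only [arrayOp, h, Finset.sum_add_distrib, Finset.sum_ite_irrel, Finset.sum_const_zero,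
    Finset.sum_ite_eq, Finset.mem_univ, if_true, Pi.sub_apply, Pi.smul_apply, heckeOp_apply]
  rcases lt_trichotomy i j with h | rfl | h
  · simp only [h.ne, h.ne', h, h.not_gt, if_true, if_false]
    module
  · simp
    module
  · simp [h.ne, h.ne', h, h.not_gt]

/-- Transposition in the first tensor factor. -/
def transposeFst (Q : Matrix (Fin N × Fin N) (Fin N × Fin N) F) :
    Matrix (Fin N × Fin N) (Fin N × Fin N) F :=
  Matrix.of fun p r => Q (r.1, p.2) (p.1, r.2)

/-- The array of all products of an entry of `X` by an entry of `Y`. -/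
def outer (X Y : Matrix (Fin N) (Fin N) A) : Fin N → Fin N → Fin N → Fin N → A :=
  fun a b c d => X a b * Y c d

theorem lhs_entry (Q Q' : Matrix (Fin N × Fin N) (Fin N × Fin N) F)
    (X Y : Matrix (Fin N) (Fin N) A) (i j k l : Fin N) :
    (liftF F Q * amp1 X * liftF F (transposeFst Q') * amp2 Y :
      Matrix (Fin N × Fin N) (Fin N × Fin N) A) (i, j) (k, l) =
      arrayOp Q (fun a => arrayOp Q' (outer X Y a)) j i k l := by
  have h : arrayOp Q (fun a => arrayOp Q' (outer X Y a)) j i k l =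
      ∑ a, ∑ b, Q (i, j) (a, b) • ∑ c, ∑ d, Q' (k, b) (c, d) • (X a c * Y d l) := by
    simp only [arrayOp, outer, Finset.sum_apply, Pi.smul_apply]
  rw [h, Matrix.mul_assoc, Matrix.mul_assoc]
  simp only [Matrix.mul_apply, Fintype.sum_prod_type, amp1, amp2, liftF, transposeFst,
    Matrix.map_apply, Matrix.of_apply, ite_mul, mul_ite, zero_mul, mul_zero, Finset.sum_ite_eq,
    Finset.sum_ite_eq', Finset.mem_univ, if_true, Finset.sum_ite_irrel, Finset.sum_const_zero,
    Finset.mul_sum, Algebra.smul_def]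
  refine Finset.sum_congr rfl fun a _ => Finset.sum_congr rfl fun b _ =>
    Finset.sum_congr rfl fun c _ => Finset.sum_congr rfl fun d _ => ?_
  rw [← mul_assoc (X a c), ← Algebra.commutes (Q' (k, b) (c, d)) (X a c), mul_assoc]

theorem rhs_entry (Q Q' : Matrix (Fin N × Fin N) (Fin N × Fin N) F)
    (hQ : ∀ p r, Q p r = Q r.swap p.swap) (hQ' : ∀ p r, Q' p r = Q' r.swap p.swap)
    (X Y : Matrix (Fin N) (Fin N) A) (i j k l : Fin N) :
    (amp2 Y * liftF F (transposeFst Q') * amp1 X * liftF F Q :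
      Matrix (Fin N × Fin N) (Fin N × Fin N) A) (i, j) (k, l) =
      arrayOp Q (arrayOp Q' (outer Y X j) i) k l := by
  have h : arrayOp Q (arrayOp Q' (outer Y X j) i) k l =
      ∑ c, ∑ d, Q (l, k) (c, d) • ∑ b, ∑ a, Q' (c, i) (b, a) • (Y j b * X a d) := by
    simp only [arrayOp, outer, Finset.sum_apply, Pi.smul_apply]
  rw [h]
  simp only [Matrix.mul_apply, Fintype.sum_prod_type, amp1, amp2, liftF, transposeFst,
    Matrix.map_apply, Matrix.of_apply, ite_mul, mul_ite, zero_mul, mul_zero, Finset.sum_ite_eq,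
    Finset.sum_ite_eq', Finset.mem_univ, if_true, Finset.sum_ite_irrel, Finset.sum_const_zero,
    Algebra.smul_def]
  rw [Finset.sum_comm]
  refine Finset.sum_congr rfl fun c _ => Finset.sum_congr rfl fun d _ => ?_
  rw [← Algebra.commutes, hQ (d, c) (k, l), Prod.swap_prod_mk, Prod.swap_prod_mk]
  congr 1
  simp only [Finset.sum_mul]
  rw [Finset.sum_comm]
  refine Finset.sum_congr rfl fun b _ => Finset.sum_congr rfl fun a _ => ?_
  rw [← Algebra.commutes, hQ' (a, b) (i, c), Prod.swap_prod_mk, Prod.swap_prod_mk, mul_assoc]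

theorem Rc_swap (q : F) (p r : Fin N × Fin N) : Rc F q N p r = Rc F q N r.swap p.swap := by
  obtain ⟨a, b⟩ := p
  obtain ⟨c, d⟩ := r
  simp only [Rc, Matrix.of_apply, Prod.swap_prod_mk, Prod.mk.injEq]
  congr 1 <;> grind

theorem Rtil_swap (q : F) (p r : Fin N × Fin N) :
    Rtil F q N p r = Rtil F q N r.swap p.swap := by
  obtain ⟨a, b⟩ := p
  obtain ⟨c, d⟩ := r
  simp only [Rtil, Matrix.of_apply, Prod.swap_prod_mk, Prod.mk.injEq]
  congr 1 <;> grind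

/-- The inverse of `heckeOp`. -/
def heckeInv (q : F) (N : ℕ) (B : Type) [AddCommGroup B] [Module F B] :
    (Fin N → Fin N → B) →ₗ[F] (Fin N → Fin N → B) :=
  heckeOp q N B - (q - q⁻¹) • LinearMap.id

theorem heckeInv_apply (q : F) {B : Type} [AddCommGroup B] [Module F B]
    (x : Fin N → Fin N → B) :
    heckeInv q N B x = heckeOp q N B x - (q - q⁻¹) • x := rfl

theorem outer_heckeInv_left (q : F) (X Y : Matrix (Fin N) (Fin N) A) :
    outer (-heckeInv q N A X) Y = -heckeInv q N (Fin N → Fin N → A) (outer X Y) := by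
  ext a b c d
  change -((if a = b then q • X a b else X b a + if b < a then (q - q⁻¹) • X a b else 0)
      - (q - q⁻¹) • X a b) * Y c d =
    -((if a = b then q • outer X Y a b else outer X Y b a +
      if b < a then (q - q⁻¹) • outer X Y a b else 0) c d - (q - q⁻¹) • (X a b * Y c d))
  split_ifs <;> simp [outer, sub_mul]

theorem outer_heckeInv_right (q : F) (X Y : Matrix (Fin N) (Fin N) A) :
    outer X (-heckeInv q N A Y) =
      -familyMap N (familyMap N (heckeInv q N A)) (outer X Y) := by
  ext a b c d
  change X a b * -((if c = d then q • Y c d else Y d c + if d < c then (q - q⁻¹) • Y c d else 0)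
      - (q - q⁻¹) • Y c d) =
    -((if c = d then q • (X a b * Y c d) else X a b * Y d c +
      if d < c then (q - q⁻¹) • (X a b * Y c d) else 0) - (q - q⁻¹) • (X a b * Y c d))
  split_ifs <;> simp [mul_sub]

/-- The coefficients of a series indexed by nonnegative integers, extended by zero. -/
def zeroExtend (S : ℕ → Matrix (Fin N) (Fin N) A) (r : ℤ) : Matrix (Fin N) (Fin N) A :=
  if 0 ≤ r then S r.toNat else 0

theorem z1_eq (S : ℕ → Matrix (Fin N) (Fin N) A) (r : ℤ) : z1 S r = amp1 (zeroExtend S r) := by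
  unfold z1 zeroExtend
  split_ifs
  · rfl
  · ext p r
    simp [amp1]

theorem z2_eq (S : ℕ → Matrix (Fin N) (Fin N) A) (r : ℤ) : z2 S r = amp2 (zeroExtend S r) := by
  unfold z2 zeroExtend
  split_ifs
  · rfl
  · ext p r
    simp [amp2]

theorem affine_reflection {q : F} (hq : q ≠ 0) (S : ℕ → Matrix (Fin N) (Fin N) A)
    (h_one : S 1 = -heckeInv q N A (S 0)) (h_two : ∀ r, 2 ≤ r → S r = 0)
    (h_refl : reflLHS F q (S 0) = reflRHS F q (S 0)) (a b : ℤ) :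
    affLHS F q S a b = affRHS F q S a b := by
  have hRct : Rct F q N = transposeFst (Rc F q N) := rfl
  have hRtilt : Rtilt F q N = transposeFst (Rtil F q N) := rfl
  set T₁ := heckeOp q N (Fin N → Fin N → A) with hT₁
  set T₂ := familyMap N (heckeOp q N (Fin N → A)) with hT₂
  set T₃ := familyMap N (familyMap N (heckeOp q N A)) with hT₃
  set U₁ := heckeInv q N (Fin N → Fin N → A) with hU₁
  set U₂ := familyMap N (heckeInv q N (Fin N → A)) with hU₂
  set U₃ := familyMap N (familyMap N (heckeInv q N A)) with hU₃
  have hw : T₁ (T₂ (outer (S 0) (S 0))) = T₃ (T₂ (outer (S 0) (S 0))) := by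
    ext j i k l
    have h := congrFun (congrFun h_refl (i, j)) (k, l)
    rw [reflLHS, reflRHS, hRct, lhs_entry, rhs_entry _ _ (Rc_swap q) (Rc_swap q)] at h
    simp only [arrayOp_Rc] at h
    exact h
  have hZ : ∀ r : ℤ, r < 0 ∨ 2 ≤ r → zeroExtend S r = 0 := by
    intro r hr
    unfold zeroExtend
    split_ifs
    · exact h_two _ (by omega)
    · rfl
  have key := hecke_baxterization (q - q⁻¹) T₁ T₂ T₃ U₁ U₂ U₃ (fun _ => rfl) (fun _ => rfl)
    (fun _ => rfl) (heckeOp_heckeOp hq) (fun x => funext fun i => heckeOp_heckeOp hq (x i))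
    (fun x => funext fun i => funext fun j => heckeOp_heckeOp hq (x i j))
    (heckeOp_braid hq) (fun x => funext fun i => heckeOp_braid hq (x i))
    (heckeOp_comm q (heckeOp q N A)) _ hw
    (fun r s => outer (zeroExtend S r) (zeroExtend S s)) rfl
    (by rw [← outer_heckeInv_left, ← h_one]; rfl)
    (by rw [← outer_heckeInv_right, ← h_one]; rfl)
    (by
      change outer (S 1) (S 1) = -U₁ (outer (S 0) (S 1))
      rw [← outer_heckeInv_left, ← h_one])
    (fun r s hr => by ext; simp [hZ r hr, outer])
    (fun r s hs => by ext; simp [hZ s hs, outer]) a b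
  ext ⟨i, j⟩ ⟨k, l⟩
  have h := congrFun (congrFun (congrFun (congrFun key j) i) k) l
  rw [affLHS, affRHS]
  simp only [z1_eq, z2_eq, hRct, hRtilt, Matrix.add_apply, Matrix.sub_apply, lhs_entry,
    rhs_entry _ _ (Rc_swap q) (Rc_swap q), rhs_entry _ _ (Rc_swap q) (Rtil_swap q),
    rhs_entry _ _ (Rtil_swap q) (Rc_swap q), rhs_entry _ _ (Rtil_swap q) (Rtil_swap q),
    arrayOp_Rc, arrayOp_Rtil]
  exact h

end Entries

/-! Base change along an algebra homomorphism. -/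

section BaseChange

variable {F : Type} [Field F] {A B : Type} [Ring A] [Algebra F A] [Ring B] [Algebra F B] {N : ℕ}

theorem amp1_map (f : A →ₐ[F] B) (M : Matrix (Fin N) (Fin N) A) :
    (amp1 M).map f = amp1 (M.map f) := by
  ext p r
  simp only [amp1, Matrix.map_apply, Matrix.of_apply]
  split_ifs <;> simp

theorem amp2_map (f : A →ₐ[F] B) (M : Matrix (Fin N) (Fin N) A) :
    (amp2 M).map f = amp2 (M.map f) := by
  ext p r
  simp only [amp2, Matrix.map_apply, Matrix.of_apply]
  split_ifs <;> simp

theorem z1_map (f : A →ₐ[F] B) (S : ℕ → Matrix (Fin N) (Fin N) A) (r : ℤ) :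
    (z1 S r).map f = z1 (fun m => (S m).map f) r := by
  unfold z1
  split_ifs
  · exact amp1_map f _
  · ext; simp

theorem z2_map (f : A →ₐ[F] B) (S : ℕ → Matrix (Fin N) (Fin N) A) (r : ℤ) :
    (z2 S r).map f = z2 (fun m => (S m).map f) r := by
  unfold z2
  split_ifs
  · exact amp2_map f _
  · ext; simp

theorem liftF_map (f : A →ₐ[F] B) {m : Type} (M : Matrix m m F) :
    (liftF F M : Matrix m m A).map f = liftF F M := by
  ext
  simp [liftF]

theorem reflLHS_map (f : A →ₐ[F] B) (q : F) (S : Matrix (Fin N) (Fin N) A) :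
    (reflLHS F q S).map f = reflLHS F q (S.map f) := by
  simp only [reflLHS, Matrix.map_mul, liftF_map, amp1_map, amp2_map]

theorem reflRHS_map (f : A →ₐ[F] B) (q : F) (S : Matrix (Fin N) (Fin N) A) :
    (reflRHS F q S).map f = reflRHS F q (S.map f) := by
  simp only [reflRHS, Matrix.map_mul, liftF_map, amp1_map, amp2_map]

theorem affLHS_map (f : A →ₐ[F] B) (q : F) (S : ℕ → Matrix (Fin N) (Fin N) A) (a b : ℤ) :
    (affLHS F q S a b).map f = affLHS F q (fun m => (S m).map f) a b := by
  simp only [affLHS, Matrix.map_add f (map_add f), Matrix.map_sub f (map_sub f), Matrix.map_mul,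
    liftF_map, z1_map, z2_map]

theorem affRHS_map (f : A →ₐ[F] B) (q : F) (S : ℕ → Matrix (Fin N) (Fin N) A) (a b : ℤ) :
    (affRHS F q S a b).map f = affRHS F q (fun m => (S m).map f) a b := by
  simp only [affRHS, Matrix.map_add f (map_add f), Matrix.map_sub f (map_sub f), Matrix.map_mul,
    liftF_map, z1_map, z2_map]

end BaseChange

theorem qq_ne_zero : qq ≠ 0 := RatFunc.X_ne_zero

/-- The images of the coefficients of `S(u)` under the evaluation homomorphism. -/
def evalCoeff (n : ℕ) (r : ℕ) : Matrix (Fin (2 * n)) (Fin (2 * n)) (AlgSp FF qq n) :=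
  Matrix.of fun i j =>
    if r = 0 then sSpP FF qq n i j
    else if r = 1 then algebraMap FF _ qq * sbarSpP n i j else 0

theorem sSpP_refl (n : ℕ) :
    reflLHS FF qq (Matrix.of (sSpP FF qq n)) = reflRHS FF qq (Matrix.of (sSpP FF qq n)) := by
  have h : (SpFreeS FF n).map (RingQuot.mkAlgHom FF (SpRel FF qq n)) =
      Matrix.of (sSpP FF qq n) := rfl
  rw [← h, ← reflLHS_map, ← reflRHS_map]
  ext p r
  exact RingQuot.mkAlgHom_rel FF (SpRel.refl p r)

theorem sSpP_tri (n : ℕ) (i j : Fin (2 * n)) (h : i < j)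
    (h' : ¬(i.val % 2 = 0 ∧ j.val = i.val + 1)) : sSpP FF qq n i j = 0 := by
  rw [sSpP, RingQuot.mkAlgHom_rel FF (SpRel.tri i j h h'), map_zero]

theorem neg_smul_eq_neg_sub {F B : Type*} [Ring F] [AddCommGroup B] [Module F B] (a b : F)
    (x : B) : -b • x = -(a • x - (a - b) • x) := by
  rw [neg_smul, sub_smul, sub_sub_cancel]

theorem neg_one_smul_add {F B : Type*} [Ring F] [AddCommGroup B] [Module F B] (c : F)
    (x y : B) : (-1 : F) • y + c • x = -(y + 0 - c • x) := by
  rw [neg_one_smul]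
  abel

theorem neg_one_smul_eq {F B : Type*} [Ring F] [AddCommGroup B] [Module F B] (c : F)
    (x y : B) : (-1 : F) • y = -(y + c • x - c • x) := by
  rw [neg_one_smul, add_sub_cancel_right]

theorem evalCoeff_one (n : ℕ) :
    evalCoeff n 1 = -heckeInv qq (2 * n) (AlgSp FF qq n) (evalCoeff n 0) := by
  ext i j
  change algebraMap FF _ qq * sbarSpP n i j =
    -((if i = j then qq • sSpP FF qq n i j
        else sSpP FF qq n j i + if j < i then (qq - qq⁻¹) • sSpP FF qq n i j else 0)
      - (qq - qq⁻¹) • sSpP FF qq n i j)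
  have hq := qq_ne_zero
  have h₁ : qq * -(qq⁻¹ ^ 2) = -qq⁻¹ := by field_simp
  have h₂ : qq * -qq⁻¹ = -1 := by field_simp
  have h₃ : qq * (1 - qq⁻¹ ^ 2) = qq - qq⁻¹ := by field_simp
  simp only [sbarSpP, ← Algebra.smul_def]
  by_cases hij : i = j
  · subst hij
    simp only [if_true, smul_smul, h₁]
    exact neg_smul_eq_neg_sub _ _ _
  · simp only [if_neg hij]
    by_cases hp : i.val % 2 = 0 ∧ j.val = i.val + 1
    · have : ¬ j < i := by omega
      simp only [if_pos hp, if_neg this, smul_add, smul_smul, h₂, h₃]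
      exact neg_one_smul_add _ _ _
    · simp only [if_neg hp, smul_smul, h₂]
      rcases lt_or_gt_of_ne hij with h | h
      · simp only [sSpP_tri n i j h hp, h.not_gt, if_false]
        simpa using neg_one_smul_add (qq - qq⁻¹) 0 (sSpP FF qq n j i)
      · simp only [h, if_true]
        exact neg_one_smul_eq _ _ _

theorem evalCoeff_reflection (n : ℕ) (a b : ℤ) :
    affLHS FF qq (evalCoeff n) a b = affRHS FF qq (evalCoeff n) a b := by
  refine affine_reflection qq_ne_zero _ (evalCoeff_one n) (fun r hr => ?_) (sSpP_refl n) a b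
  ext i j
  simp [evalCoeff, show r ≠ 0 by omega, show r ≠ 1 by omega]

/-- The evaluation homomorphism on the free algebra. -/
def evalFree (n : ℕ) : FreeAlgebra FF (ASpGen n) →ₐ[FF] AlgSp FF qq n :=
  FreeAlgebra.lift FF (Sum.elim (fun x => evalCoeff n x.1 x.2.1 x.2.2) (sInvP FF qq n))

theorem evalFree_inl (n r : ℕ) (i j : Fin (2 * n)) :
    evalFree n (FreeAlgebra.ι FF (Sum.inl (r, i, j))) = evalCoeff n r i j :=
  FreeAlgebra.lift_ι_apply _ _

theorem evalFree_inr (n : ℕ) (k : Fin n) :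
    evalFree n (FreeAlgebra.ι FF (Sum.inr k)) = sInvP FF qq n k :=
  FreeAlgebra.lift_ι_apply _ _

theorem evalFree_rel (n : ℕ) ⦃x y : FreeAlgebra FF (ASpGen n)⦄ (h : ASpRel FF qq n x y) :
    evalFree n x = evalFree n y := by
  have hS : (fun m => (SfreeASp FF n m).map (evalFree n)) = evalCoeff n := by
    ext m i j
    exact evalFree_inl n m i j
  cases h with
  | tri i j h h' =>
    rw [evalFree_inl, map_zero]
    exact sSpP_tri n i j h h'
  | quad k =>
    have h := RingQuot.mkAlgHom_rel FF (SpRel.quad (F := FF) (q := qq) k)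
    simp only [map_add, map_mul, AlgHom.commutes] at h
    simp only [map_add, map_mul, AlgHom.commutes, evalFree_inl]
    exact h
  | invR k =>
    have h := RingQuot.mkAlgHom_rel FF (SpRel.invR (F := FF) (q := qq) k)
    simp only [map_one, map_mul] at h
    simp only [map_one, map_mul, evalFree_inl, evalFree_inr]
    exact h
  | invL k =>
    have h := RingQuot.mkAlgHom_rel FF (SpRel.invL (F := FF) (q := qq) k)
    simp only [map_one, map_mul] at h
    simp only [map_one, map_mul, evalFree_inl, evalFree_inr]
    exact h
  | refl a b p r =>
    have h := congrFun (congrFun (evalCoeff_reflection n a b) p) r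
    rw [← hS, ← affLHS_map, ← affRHS_map] at h
    exact h

/-- The evaluation homomorphism. -/
def evalHom (n : ℕ) : AlgASp FF qq n →ₐ[FF] AlgSp FF qq n :=
  RingQuot.liftAlgHom FF ⟨evalFree n, evalFree_rel n⟩

theorem evalHom_sASp (n r : ℕ) (i j : Fin (2 * n)) :
    evalHom n (sASp FF qq n r i j) = evalCoeff n r i j := by
  rw [evalHom, sASp, RingQuot.liftAlgHom_mkAlgHom_apply, evalFree_inl]

theorem evalHom_sInvASp (n : ℕ) (k : Fin n) :
    evalHom n (sInvASp FF qq n k) = sInvP FF qq n k := by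
  rw [evalHom, sInvASp, RingQuot.liftAlgHom_mkAlgHom_apply, evalFree_inr]

theorem evalHom_surjective (n : ℕ) : Function.Surjective (evalHom n) := by
  intro y
  obtain ⟨x, rfl⟩ := RingQuot.mkAlgHom_surjective FF (SpRel FF qq n) y
  change _ ∈ (evalHom n).range
  induction x using FreeAlgebra.induction with
  | grade0 c =>
    rw [AlgHom.commutes]
    exact Subalgebra.algebraMap_mem _ _
  | grade1 g =>
    rcases g with ⟨i, j⟩ | k
    · exact ⟨_, evalHom_sASp n 0 i j⟩
    · exact ⟨_, evalHom_sInvASp n k⟩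
  | mul x y hx hy =>
    rw [map_mul]
    exact mul_mem hx hy
  | add x y hx hy =>
    rw [map_add]
    exact add_mem hx hy

/-- The assignment `S(u) ↦ S + q u⁻¹ S̄`, `(s_{ii'}^{(0)})^{-1} ↦
s_{ii'}^{-1}` defines a surjective algebra homomorphism (the evaluation homomorphism)
`Y^tw_q(sp_2n) → U^tw_q(sp_2n)`. -/
theorem stmt16 (n : ℕ) :
    ∃ φ : AlgASp FF qq n →ₐ[FF] AlgSp FF qq n,
      Function.Surjective φ ∧
      (∀ i j : Fin (2 * n), φ (sASp FF qq n 0 i j) = sSpP FF qq n i j) ∧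
      (∀ i j : Fin (2 * n),
        φ (sASp FF qq n 1 i j) = algebraMap FF _ qq * sbarSpP n i j) ∧
      (∀ (r : ℕ) (i j : Fin (2 * n)), 2 ≤ r → φ (sASp FF qq n r i j) = 0) ∧
      ∀ k : Fin n, φ (sInvASp FF qq n k) = sInvP FF qq n k := by
  refine ⟨evalHom n, evalHom_surjective n, evalHom_sASp n 0, evalHom_sASp n 1,
    fun r i j hr => ?_, evalHom_sInvASp n⟩
  rw [evalHom_sASp]
  simp [evalCoeff, show r ≠ 0 by omega, show r ≠ 1 by omega]
end
end

section
/- In End (ℂᴺ)^{⊗r} over F = ℂ(q), the specialized product of trigonometric R-matrices satisfies R(1, q⁻², …, q^{−2r+2}) = ∏_{0≤i<j≤r−1} (q^{−2i} − q^{−2j}) · A^q_r, where R(u₁,…,u_r) = ∏_{i<j} R_ij(u_i,u_j) with the product taken in lexicographic order on the pairs (i,j), and A^q_r is the q-antisymmetrizer. -/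
noncomputable section

open scoped TensorProduct

/-- The action of `R_{ij}(u,v)` on a vector of `(F^N)^{⊗ r}`, in coordinates. -/
def rtrigAct {F : Type} [Field F] (q : F) {N r : ℕ} (i j : Fin r) (u v : F)
    (Y : (Fin r → Fin N) → F) (f : Fin r → Fin N) : F :=
  if f i = f j then (q⁻¹ * u - q * v) * Y f
  else (u - v) * Y f + (q⁻¹ - q) * (if f j < f i then u else v) * Y (f ∘ Equiv.swap i j)

theorem big2_mulVec_apply {F : Type} [Field F] {N r : ℕ} {i j : Fin r} (hij : i ≠ j)
    (M : Matrix (Fin N × Fin N) (Fin N × Fin N) F) (Y : (Fin r → Fin N) → F)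
    (f : Fin r → Fin N) :
    (big2 F i j M).mulVec Y f =
      ∑ p : Fin N × Fin N, M (f i, f j) p *
        Y (Function.update (Function.update f i p.1) j p.2) := by
  simp only [Matrix.mulVec, dotProduct, big2, Matrix.of_apply, ite_mul, zero_mul]
  rw [← Finset.sum_filter]
  symm
  refine Finset.sum_bij' (fun p _ => Function.update (Function.update f i p.1) j p.2)
    (fun g _ => (g i, g j)) ?_ ?_ ?_ ?_ ?_
  · intro p _
    simp only [Finset.mem_filter, Finset.mem_univ, true_and]
    intro k hki hkj
    simp [Function.update_of_ne, hki, hkj]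
  · simp
  · intro p _
    simp [Function.update_of_ne, hij]
  · intro g hg
    simp only [Finset.mem_filter, Finset.mem_univ, true_and] at hg
    funext k
    by_cases hkj : k = j
    · subst hkj; simp
    by_cases hki : k = i
    · subst hki; simp [Function.update_of_ne, hkj]
    · simp [Function.update_of_ne, hki, hkj, hg k hki hkj]
  · intro p _
    simp [Function.update_of_ne, hij]

theorem update_update_eq_comp_swap {r : ℕ} {α : Type} {i j : Fin r} (f : Fin r → α) :
    Function.update (Function.update f i (f j)) j (f i) = f ∘ Equiv.swap i j := by
  funext k
  by_cases hkj : k = j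
  · subst hkj; simp
  by_cases hki : k = i
  · subst hki; simp [Function.update_of_ne, hkj]
  · simp [Function.update_of_ne, hki, hkj, Equiv.swap_apply_of_ne_of_ne]

theorem big2_Rtrig_mulVec {F : Type} [Field F] (q : F) {N r : ℕ} {i j : Fin r} (hij : i ≠ j)
    (u v : F) (Y : (Fin r → Fin N) → F) :
    (big2 F i j (Rtrig F q N u v)).mulVec Y = rtrigAct q i j u v Y := by
  funext f
  rw [big2_mulVec_apply hij]
  have key : ∀ p : Fin N × Fin N, Rtrig F q N u v (f i, f j) p *
        Y (Function.update (Function.update f i p.1) j p.2)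
      = (if p = (f i, f j) then
          (if f i = f j then q⁻¹ * u - q * v else u - v) * Y f else 0)
        + (if p = (f j, f i) then (if f i = f j then 0 else
          (q⁻¹ - q) * (if f j < f i then u else v) * Y (f ∘ Equiv.swap i j)) else 0) := by
    rintro ⟨x, y⟩
    rw [← update_update_eq_comp_swap f]
    simp only [Rtrig, Matrix.of_apply, Prod.mk.injEq]
    by_cases h1 : x = f i ∧ y = f j
    · obtain ⟨rfl, rfl⟩ := h1
      rw [Function.update_eq_self, Function.update_eq_self]
      by_cases h : f i = f j
      · simp [h]
      · simp [h, Ne.symm h]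
    · by_cases h2 : x = f j ∧ y = f i
      · obtain ⟨rfl, rfl⟩ := h2
        by_cases h : f i = f j
        · simp [h] at h1
        · simp [h]
      · have h1' : ¬ (f i = x ∧ f j = y) := fun h => h1 ⟨h.1.symm, h.2.symm⟩
        have h2' : ¬ (f i = y ∧ f j = x ∧ f i ≠ f j) := fun h => h2 ⟨h.2.1.symm, h.1.symm⟩
        rw [if_neg h1', if_neg h2', if_neg h1, if_neg h2]
        simp
  rw [Finset.sum_congr rfl fun p _ => key p, Finset.sum_add_distrib]
  simp only [Finset.sum_ite_eq', Finset.mem_univ, if_true, rtrigAct]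
  split_ifs <;> simp

/-- The number of inversions of a word. -/
def wordInv {r : ℕ} {α : Type} [LinearOrder α] (f : Fin r → α) : ℕ :=
  (Finset.univ.filter fun p : Fin r × Fin r => p.1 < p.2 ∧ f p.2 < f p.1).card

theorem wordInv_of_descent {r : ℕ} {α : Type} [LinearOrder α] (f : Fin r → α) {i i' : Fin r}
    (hi : i.val + 1 = i'.val) (hf : f i' < f i) :
    wordInv f = wordInv (f ∘ Equiv.swap i i') + 1 := by
  have hii : i < i' := by rw [Fin.lt_def]; omega
  have hmem : (i, i') ∈ Finset.univ.filter
      fun p : Fin r × Fin r => p.1 < p.2 ∧ f p.2 < f p.1 := by simp [hii, hf]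
  unfold wordInv
  rw [← Finset.card_erase_add_one hmem]
  congr 1
  have hs : ∀ a b : Fin r, a < b → ¬ (a = i ∧ b = i') →
      Equiv.swap i i' a < Equiv.swap i i' b := by
    intro a b hab hne
    simp only [Equiv.swap_apply_def]
    simp only [Fin.lt_def, Fin.ext_iff] at *
    split_ifs <;> omega
  refine Finset.card_bij'
    (fun p _ => (Equiv.swap i i' p.1, Equiv.swap i i' p.2))
    (fun p _ => (Equiv.swap i i' p.1, Equiv.swap i i' p.2)) ?_ ?_ ?_ ?_
  · rintro ⟨a, b⟩ h
    simp only [Finset.mem_erase, Finset.mem_filter, Finset.mem_univ, true_and, ne_eq,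
      Prod.mk.injEq, Function.comp_apply, Equiv.swap_apply_self] at h ⊢
    exact ⟨hs a b h.2.1 h.1, h.2.2⟩
  · rintro ⟨a, b⟩ h
    simp only [Finset.mem_erase, Finset.mem_filter, Finset.mem_univ, true_and, ne_eq,
      Prod.mk.injEq, Function.comp_apply] at h ⊢
    have hne : ¬ (a = i ∧ b = i') := by
      rintro ⟨rfl, rfl⟩
      simp only [Equiv.swap_apply_left, Equiv.swap_apply_right] at h
      exact lt_asymm h.2 hf
    refine ⟨?_, hs a b h.1 hne, h.2⟩
    rintro ⟨ha, hb⟩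
    have ha' : a = i' := by simpa using congrArg (Equiv.swap i i') ha
    have hb' : b = i := by simpa using congrArg (Equiv.swap i i') hb
    subst ha' hb'
    exact lt_asymm h.1 hii
  · simp
  · simp

/-- q-antisymmetry of a vector in the tensor factors `i`, `i'`. -/
def QAnti {F : Type} [Field F] (q : F) {N r : ℕ} (i i' : Fin r)
    (Y : (Fin r → Fin N) → F) : Prop :=
  (∀ f, f i = f i' → Y f = 0) ∧
    ∀ f, f i' < f i → Y f = -q * Y (f ∘ Equiv.swap i i')

theorem qAnti_rtrigAct_self {F : Type} [Field F] {q : F} (hq : q ≠ 0) {N r : ℕ} {i i' : Fin r}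
    (u v : F) (huv : v = q⁻¹ ^ 2 * u) (Y : (Fin r → Fin N) → F) :
    QAnti q i i' (rtrigAct q i i' u v Y) := by
  subst huv
  refine ⟨fun f hf => ?_, fun f hf => ?_⟩
  · simp only [rtrigAct, hf, if_true]
    field_simp
    ring
  · have h1 : f ∘ Equiv.swap i i' ∘ Equiv.swap i i' = f := by
      funext k; simp
    simp only [rtrigAct, Function.comp_apply, Equiv.swap_apply_left, Equiv.swap_apply_right,
      Function.comp_assoc, h1, hf, hf.ne, hf.ne', if_true, if_false, hf.not_gt]
    field_simp
    ring

theorem qAnti_rtrigAct_of_disjoint {F : Type} [Field F] {q : F} {N r : ℕ} {i i' k j : Fin r}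
    (hki : k ≠ i) (hki' : k ≠ i') (hji : j ≠ i) (hji' : j ≠ i')
    (u v : F) {Y : (Fin r → Fin N) → F} (hY : QAnti q i i' Y) :
    QAnti q i i' (rtrigAct q k j u v Y) := by
  have hcomm : ∀ f : Fin r → Fin N,
      f ∘ Equiv.swap i i' ∘ Equiv.swap k j = (f ∘ Equiv.swap k j) ∘ Equiv.swap i i' := by
    intro f
    funext x
    simp only [Function.comp_apply, Equiv.swap_apply_def]
    congr 1
    grind
  refine ⟨fun f hf => ?_, fun f hf => ?_⟩
  · have h2 := hY.1 (f ∘ Equiv.swap k j)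
    simp only [Function.comp_apply, Equiv.swap_apply_of_ne_of_ne hki.symm hji.symm,
      Equiv.swap_apply_of_ne_of_ne hki'.symm hji'.symm] at h2
    simp [rtrigAct, hY.1 f hf, h2 hf]
  · have h2 := hY.2 (f ∘ Equiv.swap k j)
    simp only [Function.comp_apply, Equiv.swap_apply_of_ne_of_ne hki.symm hji.symm,
      Equiv.swap_apply_of_ne_of_ne hki'.symm hji'.symm] at h2
    simp only [rtrigAct, Function.comp_apply, Equiv.swap_apply_of_ne_of_ne hki hki',
      Equiv.swap_apply_of_ne_of_ne hji hji', hY.2 f hf, Function.comp_assoc f, hcomm, h2 hf]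
    split_ifs <;> ring

set_option linter.unusedSimpArgs false in
theorem fusion_identity {F α : Type} [Field F] [LinearOrder α] {q : F} (hq : q ≠ 0) (u v v' : F)
    (hv : v' = q⁻¹ ^ 2 * v) (Z H G : α → α → α → F)
    (hZ0 : ∀ x y, Z x y y = 0) (hZ : ∀ x y z, z < y → Z x y z = -q * Z x z y)
    (hH : ∀ x y z, H x y z = if x = z then (q⁻¹ * u - q * v') * Z x y z
      else (u - v') * Z x y z + (q⁻¹ - q) * (if z < x then u else v') * Z z y x)
    (hG : ∀ x y z, G x y z = if x = y then (q⁻¹ * u - q * v) * H x y z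
      else (u - v) * H x y z + (q⁻¹ - q) * (if y < x then u else v) * H y x z) :
    (∀ x y, G x y y = 0) ∧ ∀ x y z, z < y → G x y z = -q * G x z y := by
  subst hv
  constructor
  · intro x y
    rcases lt_trichotomy x y with h | h | h
    · simp only [hG, hH, hZ0, h.ne, h.ne', h, h.not_gt, if_true, if_false, hZ y y x h]
      field_simp
      ring
    · subst h
      simp [hG, hH, hZ0]
    · simp only [hG, hH, hZ0, h.ne, h.ne', h, h.not_gt, if_true, if_false, hZ y x y h]
      field_simp
      ring
  · intro x y z hzy
    rcases lt_trichotomy x y with h | h | h <;> rcases lt_trichotomy x z with h' | h' | h'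
    · simp only [hG, hH, hZ0, h.ne, h.ne', h, h.not_gt, h'.ne, h'.ne', h', h'.not_gt, hzy,
        hzy.ne, hzy.ne', hzy.not_gt, if_true, if_false, hZ x y z hzy, hZ y z x h', hZ z y x h]
      field_simp
      ring
    · subst h'
      simp only [hG, hH, hZ0, h.ne, h.ne', h, h.not_gt, hzy,
        hzy.ne, hzy.ne', hzy.not_gt, if_true, if_false, hZ x y x hzy]
      field_simp
      ring
    · simp only [hG, hH, hZ0, h.ne, h.ne', h, h.not_gt, h'.ne, h'.ne', h', h'.not_gt, hzy,
        hzy.ne, hzy.ne', hzy.not_gt, if_true, if_false, hZ x y z hzy, hZ y x z h', hZ z y x h]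
      field_simp
      ring
    · exact absurd (h ▸ h') hzy.not_gt
    · exact absurd (h ▸ h') hzy.ne'
    · subst h
      simp only [hG, hH, hZ0, hzy,
        hzy.ne, hzy.ne', hzy.not_gt, if_true, if_false, hZ x x z hzy]
      field_simp
      ring
    · exact absurd (h'.trans hzy) h.not_gt
    · exact absurd (h' ▸ hzy) h.not_gt
    · simp only [hG, hH, hZ0, h.ne, h.ne', h, h.not_gt, h'.ne, h'.ne', h', h'.not_gt, hzy,
        hzy.ne, hzy.ne', hzy.not_gt, if_true, if_false, hZ x y z hzy, hZ y x z h', hZ z x y h]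
      field_simp
      ring

/-- The word `f` with the letters at `k`, `i`, `i'` replaced. -/
def setThree {r : ℕ} {α : Type} (f : Fin r → α) (k i i' : Fin r) (x y z : α) : Fin r → α :=
  fun t => if t = k then x else if t = i then y else if t = i' then z else f t

theorem setThree_self {r : ℕ} {α : Type} (f : Fin r → α) (k i i' : Fin r) :
    setThree f k i i' (f k) (f i) (f i') = f := by
  funext t
  simp only [setThree]
  grind

theorem qAnti_rtrigAct_fusion {F : Type} [Field F] {q : F} (hq : q ≠ 0) {N r : ℕ}
    {k i i' : Fin r} (hki : k ≠ i) (hki' : k ≠ i') (hii : i ≠ i') (u v v' : F)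
    (hv : v' = q⁻¹ ^ 2 * v) {Y : (Fin r → Fin N) → F} (hY : QAnti q i i' Y) :
    QAnti q i i' (rtrigAct q k i u v (rtrigAct q k i' u v' Y)) := by
  have s1 : ∀ (f : Fin r → Fin N) x y z,
      setThree f k i i' x y z ∘ Equiv.swap k i = setThree f k i i' y x z := by
    intro f x y z
    funext t
    simp only [setThree, Function.comp_apply, Equiv.swap_apply_def]
    grind
  have s2 : ∀ (f : Fin r → Fin N) x y z,
      setThree f k i i' x y z ∘ Equiv.swap k i' = setThree f k i i' z y x := by
    intro f x y z
    funext t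
    simp only [setThree, Function.comp_apply, Equiv.swap_apply_def]
    grind
  have s3 : ∀ (f : Fin r → Fin N) x y z,
      setThree f k i i' x y z ∘ Equiv.swap i i' = setThree f k i i' x z y := by
    intro f x y z
    funext t
    simp only [setThree, Function.comp_apply, Equiv.swap_apply_def]
    grind
  have ek : ∀ (f : Fin r → Fin N) x y z, setThree f k i i' x y z k = x := by
    simp [setThree]
  have ei : ∀ (f : Fin r → Fin N) x y z, setThree f k i i' x y z i = y := by
    simp [setThree, hki.symm]
  have ei' : ∀ (f : Fin r → Fin N) x y z, setThree f k i i' x y z i' = z := by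
    simp [setThree, hki'.symm, hii.symm]
  have main : ∀ f : Fin r → Fin N, _ := fun f =>
    fusion_identity hq u v v' hv
      (fun x y z => Y (setThree f k i i' x y z))
      (fun x y z => rtrigAct q k i' u v' Y (setThree f k i i' x y z))
      (fun x y z => rtrigAct q k i u v (rtrigAct q k i' u v' Y) (setThree f k i i' x y z))
      (fun x y => hY.1 _ (by rw [ei, ei']))
      (fun x y z h => by rw [hY.2 _ (by rwa [ei, ei']), s3])
      (fun x y z => by simp only [rtrigAct, ek, ei', s2])
      (fun x y z => by simp only [rtrigAct.eq_1 q k i, ek, ei, s1])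
  refine ⟨fun f hf => ?_, fun f hf => ?_⟩
  · have := (main f).1 (f k) (f i)
    rwa [show setThree f k i i' (f k) (f i) (f i) = f by
      conv_rhs => rw [← setThree_self f k i i']
      rw [hf]] at this
  · have := (main f).2 (f k) (f i) (f i') hf
    rwa [← s3 f (f k) (f i) (f i'), setThree_self] at this

theorem perm_induction_of_invCount {r : ℕ} {P : Equiv.Perm (Fin r) → Prop} (one : P 1)
    (step : ∀ (σ : Equiv.Perm (Fin r)) (i : ℕ) (h : i + 1 < r),
      invCount (σ * Equiv.swap ⟨i, Nat.lt_of_succ_lt h⟩ ⟨i + 1, h⟩) = invCount σ + 1 →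
        P σ → P (σ * Equiv.swap ⟨i, Nat.lt_of_succ_lt h⟩ ⟨i + 1, h⟩))
    (σ : Equiv.Perm (Fin r)) : P σ := by
  induction hn : invCount σ using Nat.strong_induction_on generalizing σ with
  | _ n ih =>
  by_cases hd : ∃ (i : ℕ) (h : i + 1 < r), σ ⟨i + 1, h⟩ < σ ⟨i, Nat.lt_of_succ_lt h⟩
  · obtain ⟨i, h, hlt⟩ := hd
    have hcount : invCount σ =
        invCount (σ * Equiv.swap ⟨i, Nat.lt_of_succ_lt h⟩ ⟨i + 1, h⟩) + 1 :=
      wordInv_of_descent (fun x => σ x) (i := ⟨i, Nat.lt_of_succ_lt h⟩) (i' := ⟨i + 1, h⟩) rfl hlt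
    have hback : σ * Equiv.swap ⟨i, Nat.lt_of_succ_lt h⟩ ⟨i + 1, h⟩ *
        Equiv.swap ⟨i, Nat.lt_of_succ_lt h⟩ ⟨i + 1, h⟩ = σ := by
      rw [mul_assoc, Equiv.swap_mul_self, mul_one]
    rw [← hback]
    exact step _ i h (by rw [hback, hcount]) (ih _ (by omega) _ rfl)
  · push Not at hd
    have hmono : StrictMono σ := by
      rcases r with _ | n
      · exact fun a => a.elim0
      · rw [Fin.strictMono_iff_lt_succ]
        intro i
        refine lt_of_le_of_ne (hd i.val (by omega)) ?_
        exact fun h => (Fin.castSucc_lt_succ (i := i)).ne (σ.injective h)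
    have hid : ⇑σ = id :=
      (hmono.range_inj strictMono_id).1 (by simp [σ.surjective.range_eq])
    have : σ = 1 := Equiv.ext fun x => congrFun hid x
    rwa [this]

theorem PqSmall_mulVec {F : Type} [Field F] (q : F) {N r : ℕ} {i j : Fin r} (hij : i ≠ j)
    (Y : (Fin r → Fin N) → F) (f : Fin r → Fin N) :
    (big2 F i j (PqSmall F q N)).mulVec Y f =
      (if f i = f j then 1 else if f j < f i then q else q⁻¹) * Y (f ∘ Equiv.swap i j) := by
  rw [big2_mulVec_apply hij, ← update_update_eq_comp_swap f, Finset.sum_eq_single (f j, f i)]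
  · simp [PqSmall]
  · rintro ⟨x, y⟩ _ hne
    have : ¬ (x = f j ∧ y = f i) := fun h => hne (by rw [h.1, h.2])
    simp [PqSmall, this]
  · simp

theorem zpow_wordInv_comp_swap {F : Type} [Field F] {q : F} (hq : q ≠ 0) {N r : ℕ}
    {i i' : Fin r} (hi : i.val + 1 = i'.val) (f : Fin r → Fin N) :
    (if f i = f i' then 1 else if f i' < f i then q else q⁻¹) *
      q ^ (wordInv (f ∘ Equiv.swap i i') : ℤ) = q ^ (wordInv f : ℤ) := by
  rcases lt_trichotomy (f i) (f i') with h | h | h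
  · have hc := wordInv_of_descent (f ∘ Equiv.swap i i') hi (by simpa using h)
    rw [Function.comp_assoc, show ⇑(Equiv.swap i i') ∘ ⇑(Equiv.swap i i') = id by
      funext k; simp, Function.comp_id] at hc
    rw [if_neg h.ne, if_neg h.not_gt, hc, Nat.cast_succ, zpow_add_one₀ hq]
    field_simp
  · rw [if_pos h, one_mul, ← update_update_eq_comp_swap, ← h, Function.update_eq_self, h,
      Function.update_eq_self]
  · rw [if_neg h.ne', if_pos h, wordInv_of_descent f hi h, Nat.cast_succ, zpow_add_one₀ hq,
      mul_comm]

/-- In coordinates `P^q_σ` is the permutation of tensor factors, rescaled by the numbers of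
inversions of the words. -/
theorem PqExt.apply_eq {F : Type} [Field F] {q : F} (hq : q ≠ 0) {N r : ℕ}
    {Pq : Equiv.Perm (Fin r) → Matrix (Fin r → Fin N) (Fin r → Fin N) F}
    (hPq : PqExt F q N r Pq) (σ : Equiv.Perm (Fin r)) (f g : Fin r → Fin N) :
    Pq σ f g = if f ∘ σ = g then q ^ (wordInv f : ℤ) * (q ^ (wordInv g : ℤ))⁻¹ else 0 := by
  induction σ using perm_induction_of_invCount generalizing f g with
  | one =>
    have hz : q ^ (wordInv g : ℤ) ≠ 0 := zpow_ne_zero _ hq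
    rw [hPq.1, Matrix.one_apply, Equiv.Perm.coe_one, Function.comp_id]
    split_ifs with h
    · rw [h, mul_inv_cancel₀ hz]
    · rfl
  | step σ i h hc ih =>
    set a : Fin r := ⟨i, Nat.lt_of_succ_lt h⟩
    set b : Fin r := ⟨i + 1, h⟩
    have hab : a ≠ b := by simp [a, b]
    rw [hPq.2 σ i h hc, Matrix.mul_apply]
    have hcol : ∀ k, big2 F a b (PqSmall F q N) k g =
        (if k a = k b then 1 else if k b < k a then q else q⁻¹) *
          (Pi.single g 1 : (Fin r → Fin N) → F) (k ∘ Equiv.swap a b) := by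
      intro k
      rw [← PqSmall_mulVec q hab, Matrix.mulVec_single_one]
      rfl
    rw [Finset.sum_eq_single (f ∘ σ)]
    · rw [ih, if_pos rfl, hcol, Pi.single_apply, Equiv.Perm.coe_mul, ← Function.comp_assoc]
      by_cases h1 : (f ∘ σ) ∘ Equiv.swap a b = g
      · have hz : ∀ n : ℕ, q ^ (n : ℤ) ≠ 0 := fun n => zpow_ne_zero _ hq
        have hw := zpow_wordInv_comp_swap hq (i := a) (i' := b) rfl (f ∘ σ)
        rw [h1] at hw
        rw [if_pos h1, if_pos h1, mul_one, eq_mul_inv_iff_mul_eq₀ (hz _), mul_assoc, hw,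
          inv_mul_cancel_right₀ (hz _)]
      · rw [if_neg h1, if_neg h1, mul_zero, mul_zero]
    · intro k _ hk
      rw [ih, if_neg (Ne.symm hk), zero_mul]
    · simp

theorem QAnti.comp_perm {F : Type} [Field F] {q : F} (hq : q ≠ 0) {N r : ℕ}
    {Y : (Fin r → Fin N) → F}
    (hY : ∀ i i' : Fin r, i.val + 1 = i'.val → QAnti q i i' Y) (σ : Equiv.Perm (Fin r))
    (f : Fin r → Fin N) :
    (q ^ (wordInv (f ∘ σ) : ℤ))⁻¹ * Y (f ∘ σ) =
      ((Equiv.Perm.sign σ : ℤ) : F) * ((q ^ (wordInv f : ℤ))⁻¹ * Y f) := by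
  induction σ using perm_induction_of_invCount generalizing f with
  | one => simp
  | step σ i h hc ih =>
    set a : Fin r := ⟨i, Nat.lt_of_succ_lt h⟩
    set b : Fin r := ⟨i + 1, h⟩
    have hab : a ≠ b := by simp [a, b]
    have hs : ∀ g : Fin r → Fin N, g b < g a →
        (q ^ (wordInv g : ℤ))⁻¹ * Y g =
          -((q ^ (wordInv (g ∘ Equiv.swap a b) : ℤ))⁻¹ * Y (g ∘ Equiv.swap a b)) := by
      intro g hg
      have hz : q ^ (wordInv (g ∘ Equiv.swap a b) : ℤ) ≠ 0 := zpow_ne_zero _ hq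
      rw [(hY a b rfl).2 g hg, wordInv_of_descent g (i := a) (i' := b) rfl hg, Nat.cast_succ,
        zpow_add_one₀ hq]
      field_simp
    have hall : ∀ g : Fin r → Fin N,
        (q ^ (wordInv (g ∘ Equiv.swap a b) : ℤ))⁻¹ * Y (g ∘ Equiv.swap a b) =
          -((q ^ (wordInv g : ℤ))⁻¹ * Y g) := by
      intro g
      have hgg : (g ∘ Equiv.swap a b) ∘ Equiv.swap a b = g := by funext k; simp
      rcases lt_trichotomy (g a) (g b) with h1 | h1 | h1
      · have := hs (g ∘ Equiv.swap a b) (by simpa using h1)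
        rwa [hgg] at this
      · rw [(hY a b rfl).1 g h1, (hY a b rfl).1 (g ∘ Equiv.swap a b) (by simp [h1])]
        simp
      · rw [hs g h1, neg_neg]
    rw [Equiv.Perm.coe_mul, ← Function.comp_assoc, hall, ih, Equiv.Perm.sign_mul,
      Equiv.Perm.sign_swap hab]
    push_cast
    ring

/-- The action of the product of the `R_{ij}(u_i,u_j)` over a list of pairs. -/
def rtrigListAct {F : Type} [Field F] (q : F) {N r : ℕ} (u : Fin r → F)
    (L : List (Fin r × Fin r)) (Y : (Fin r → Fin N) → F) : (Fin r → Fin N) → F :=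
  L.foldr (fun p Z => rtrigAct q p.1 p.2 (u p.1) (u p.2) Z) Y

theorem rtrigListAct_append {F : Type} [Field F] (q : F) {N r : ℕ} (u : Fin r → F)
    (L L' : List (Fin r × Fin r)) (Y : (Fin r → Fin N) → F) :
    rtrigListAct q u (L ++ L') Y = rtrigListAct q u L (rtrigListAct q u L' Y) :=
  List.foldr_append ..

theorem prod_big2_Rtrig_mulVec {F : Type} [Field F] (q : F) {N r : ℕ} (u : Fin r → F)
    (L : List (Fin r × Fin r)) (hL : ∀ p ∈ L, p.1 ≠ p.2) (Y : (Fin r → Fin N) → F) :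
    (L.map fun p => big2 F p.1 p.2 (Rtrig F q N (u p.1) (u p.2))).prod.mulVec Y =
      rtrigListAct q u L Y := by
  induction L with
  | nil => simp [rtrigListAct]
  | cons p L ih =>
    rw [List.map_cons, List.prod_cons, ← Matrix.mulVec_mulVec,
      ih fun p hp => hL p (List.mem_cons_of_mem _ hp),
      big2_Rtrig_mulVec q (hL p List.mem_cons_self)]
    rfl

/-- The pairs `(k,j)` with `k < j`, for fixed `k`. -/
def rowPairs {r : ℕ} (k : Fin r) : List (Fin r × Fin r) :=
  ((List.finRange r).filter fun j => k < j).map fun j => (k, j)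

theorem exists_finRange_eq_append {r : ℕ} {i i' : Fin r} (hi : i.val + 1 = i'.val) :
    ∃ pre post : List (Fin r), List.finRange r = pre ++ i :: i' :: post ∧
      (∀ k ∈ pre, k < i) ∧ ∀ k ∈ post, i' < k := by
  have hlen : (List.finRange r).length = r := List.length_finRange
  have hdrop : (List.finRange r).drop i.val = i :: i' :: (List.finRange r).drop (i.val + 1 + 1) := by
    rw [List.drop_eq_getElem_cons (by rw [hlen]; exact i.isLt),
      List.drop_eq_getElem_cons (by rw [hlen]; omega)]
    simp only [List.getElem_finRange, Fin.cast_mk, Fin.eta, hi]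
  have hsplit := (List.take_append_drop i.val (List.finRange r)).symm
  rw [hdrop] at hsplit
  have hpw := List.pairwise_lt_finRange r
  rw [hsplit, List.pairwise_append] at hpw
  refine ⟨_, _, hsplit, fun k hk => hpw.2.2 k hk i List.mem_cons_self, fun k hk => ?_⟩
  exact (List.pairwise_cons.1 (List.pairwise_cons.1 hpw.2.1).2).1 k hk

theorem qAnti_rtrigListAct_of_disjoint {F : Type} [Field F] {q : F} {N r : ℕ} {i i' : Fin r}
    (u : Fin r → F) (L : List (Fin r × Fin r))
    (hL : ∀ p ∈ L, p.1 ≠ i ∧ p.1 ≠ i' ∧ p.2 ≠ i ∧ p.2 ≠ i')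
    {Y : (Fin r → Fin N) → F} (hY : QAnti q i i' Y) : QAnti q i i' (rtrigListAct q u L Y) := by
  induction L with
  | nil => exact hY
  | cons p L ih =>
    obtain ⟨h1, h2, h3, h4⟩ := hL p List.mem_cons_self
    exact qAnti_rtrigAct_of_disjoint h1 h2 h3 h4 _ _
      (ih fun p hp => hL p (List.mem_cons_of_mem _ hp))

theorem qAnti_rtrigListAct_rowPairs {F : Type} [Field F] {q : F} (hq : q ≠ 0) {N r : ℕ}
    {i i' k : Fin r} (hi : i.val + 1 = i'.val) (hk : k < i) (u : Fin r → F)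
    (hu : u i' = q⁻¹ ^ 2 * u i) {Y : (Fin r → Fin N) → F} (hY : QAnti q i i' Y) :
    QAnti q i i' (rtrigListAct q u (rowPairs k) Y) := by
  obtain ⟨pre, post, hsplit, hpre, hpost⟩ := exists_finRange_eq_append hi
  have hii : i < i' := by rw [Fin.lt_def]; omega
  have hrow : rowPairs k = (pre.filter fun j => k < j).map (fun j => (k, j)) ++
      ([(k, i), (k, i')] ++ (post.filter fun j => k < j).map fun j => (k, j)) := by
    simp [rowPairs, hsplit, hk, hk.trans hii]
  rw [hrow, rtrigListAct_append, rtrigListAct_append]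
  refine qAnti_rtrigListAct_of_disjoint u _ ?_
    (qAnti_rtrigAct_fusion hq hk.ne (hk.trans hii).ne hii.ne _ _ _ hu
      (qAnti_rtrigListAct_of_disjoint u _ ?_ hY))
  · intro p hp
    obtain ⟨j, hj, rfl⟩ := List.mem_map.1 hp
    have hji := hpre j (List.mem_filter.1 hj).1
    exact ⟨hk.ne, (hk.trans hii).ne, hji.ne, (hji.trans hii).ne⟩
  · intro p hp
    obtain ⟨j, hj, rfl⟩ := List.mem_map.1 hp
    have hji := hpost j (List.mem_filter.1 hj).1
    exact ⟨hk.ne, (hk.trans hii).ne, (hii.trans hji).ne', hji.ne'⟩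

theorem qAnti_rtrigListAct_pairsLex {F : Type} [Field F] {q : F} (hq : q ≠ 0) {N r : ℕ}
    {i i' : Fin r} (hi : i.val + 1 = i'.val) (u : Fin r → F)
    (hu : u i' = q⁻¹ ^ 2 * u i) (Y : (Fin r → Fin N) → F) :
    QAnti q i i' (rtrigListAct q u (pairsLex r) Y) := by
  obtain ⟨pre, post, hsplit, hpre, hpost⟩ := exists_finRange_eq_append hi
  have hii : i < i' := by rw [Fin.lt_def]; omega
  have hempty : pre.filter (fun j => decide (i < j)) = [] := by
    simpa using fun k hk => (hpre k hk).le
  have hrow : rowPairs i = (i, i') :: (post.filter fun j => i < j).map fun j => (i, j) := by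
    simp only [rowPairs, hsplit, List.filter_append, hempty, List.filter_cons]
    simp [hii]
  have hlex : pairsLex r = pre.flatMap rowPairs ++
      (rowPairs i ++ (i' :: post).flatMap rowPairs) := by
    rw [← List.flatMap_cons, ← List.flatMap_append, ← hsplit]
    rfl
  rw [hlex, rtrigListAct_append]
  clear hlex hsplit hempty
  induction pre with
  | nil =>
    rw [hrow, List.cons_append]
    exact qAnti_rtrigAct_self hq _ _ hu _
  | cons k pre ih =>
    rw [List.flatMap_cons, rtrigListAct_append]
    exact qAnti_rtrigListAct_rowPairs hq hi (hpre k List.mem_cons_self) u hu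
      (ih fun k hk => hpre k (List.mem_cons_of_mem _ hk))

theorem exists_comp_perm_of_rtrigListAct_ne_zero {F : Type} [Field F] (q : F) {N r : ℕ}
    (u : Fin r → F) (L : List (Fin r × Fin r)) (g f : Fin r → Fin N)
    (hf : rtrigListAct q u L (Pi.single g 1) f ≠ 0) : ∃ σ : Equiv.Perm (Fin r), f ∘ σ = g := by
  induction L generalizing f with
  | nil =>
    refine ⟨1, ?_⟩
    by_contra hne
    exact hf (Pi.single_eq_of_ne hne _)
  | cons p L ih =>
    by_cases h1 : rtrigListAct q u L (Pi.single g 1) f = 0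
    · by_cases h2 : rtrigListAct q u L (Pi.single g 1) (f ∘ Equiv.swap p.1 p.2) = 0
      · refine absurd ?_ hf
        change rtrigAct _ _ _ _ _ (rtrigListAct q u L (Pi.single g 1)) f = 0
        simp [rtrigAct, h1, h2]
      · obtain ⟨σ, hσ⟩ := ih _ h2
        exact ⟨Equiv.swap p.1 p.2 * σ, by rw [← hσ]; rfl⟩
    · exact ih f h1

theorem rtrigListAct_row_diag {F : Type} [Field F] (q : F) {N r : ℕ} (u : Fin r → F)
    {g : Fin r → Fin N} (hg : Function.Injective g) (m : Fin r) (L : List (Fin r))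
    (hL : L.Nodup) (hm : ∀ j ∈ L, m < j) (Y : (Fin r → Fin N) → F)
    (hY : ∀ f, Y f ≠ 0 → ∀ k ≤ m, f k = g k) :
    (∀ f, rtrigListAct q u (L.map fun j => (m, j)) Y f ≠ 0 →
      (∀ k < m, f k = g k) ∧ (f m = g m ∨ ∃ j ∈ L, f j = g m)) ∧
    rtrigListAct q u (L.map fun j => (m, j)) Y g = (L.map fun j => u m - u j).prod * Y g := by
  induction L with
  | nil =>
    exact ⟨fun f hf => ⟨fun k hk => hY f hf k hk.le, Or.inl (hY f hf m le_rfl)⟩,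
      by simp [rtrigListAct]⟩
  | cons j L ih =>
    obtain ⟨hjL, hL'⟩ := List.nodup_cons.1 hL
    obtain ⟨ih1, ih2⟩ := ih hL' fun j hj => hm j (List.mem_cons_of_mem _ hj)
    have hmj := hm j List.mem_cons_self
    set Z := rtrigListAct q u (L.map fun j => (m, j)) Y with hZ
    have hstep : rtrigListAct q u ((j :: L).map fun j => (m, j)) Y =
        rtrigAct q m j (u m) (u j) Z := rfl
    rw [hstep]
    constructor
    · intro f hf
      by_cases h1 : Z f = 0
      · have h2 : Z (f ∘ Equiv.swap m j) ≠ 0 := by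
          intro h2
          exact hf (by simp [rtrigAct, h1, h2])
        obtain ⟨ha, hb⟩ := ih1 _ h2
        refine ⟨fun k hk => ?_, Or.inr ?_⟩
        · rw [← ha k hk, Function.comp_apply,
            Equiv.swap_apply_of_ne_of_ne hk.ne (hk.trans hmj).ne]
        · rcases hb with hb | ⟨j', hj', hb⟩
          · exact ⟨j, List.mem_cons_self, by simpa using hb⟩
          · refine ⟨j', List.mem_cons_of_mem _ hj', ?_⟩
            rwa [Function.comp_apply, Equiv.swap_apply_of_ne_of_ne
              (hm j' (List.mem_cons_of_mem _ hj')).ne' (by rintro rfl; exact hjL hj')] at hb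
      · obtain ⟨ha, hb⟩ := ih1 f h1
        exact ⟨ha, hb.imp_right fun ⟨j', hj', h⟩ => ⟨j', List.mem_cons_of_mem _ hj', h⟩⟩
    · have h0 : Z (g ∘ Equiv.swap m j) = 0 := by
        by_contra hne
        rcases (ih1 _ hne).2 with h | ⟨j', hj', h⟩
        · have := hg h
          rw [Equiv.swap_apply_left] at this
          exact hmj.ne' this
        · have := hg h
          have hmj' := hm j' (List.mem_cons_of_mem _ hj')
          rw [Equiv.swap_apply_of_ne_of_ne hmj'.ne' (by rintro rfl; exact hjL hj')] at this
          exact hmj'.ne' this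
      have hne : g m ≠ g j := fun h => hmj.ne (hg h)
      rw [rtrigAct, if_neg hne, h0, ih2, List.map_cons, List.prod_cons]
      ring

theorem rtrigListAct_flatMap_diag {F : Type} [Field F] (q : F) {N r : ℕ} (u : Fin r → F)
    {g : Fin r → Fin N} (hg : Function.Injective g) (L : List (Fin r))
    (hL : L.Pairwise (· < ·)) :
    (∀ f, rtrigListAct q u (L.flatMap rowPairs) (Pi.single g 1) f ≠ 0 →
      ∀ k, (∀ i ∈ L, k < i) → f k = g k) ∧
    rtrigListAct q u (L.flatMap rowPairs) (Pi.single g 1) g =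
      (L.map fun i => (((List.finRange r).filter fun j => i < j).map fun j => u i - u j).prod).prod
      := by
  induction L with
  | nil =>
    refine ⟨fun f hf k _ => ?_, by simp [rtrigListAct]⟩
    by_cases hfg : f = g
    · rw [hfg]
    · exact absurd (Pi.single_eq_of_ne hfg _) hf
  | cons m L ih =>
    obtain ⟨hmL, hL'⟩ := List.pairwise_cons.1 hL
    obtain ⟨ih1, ih2⟩ := ih hL'
    obtain ⟨h1, h2⟩ := rtrigListAct_row_diag q u hg m
      ((List.finRange r).filter fun j => m < j) ((List.nodup_finRange r).filter _)
      (by simp) _ fun f hf k hk => ih1 f hf k fun i hi => hk.trans_lt (hmL i hi)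
    rw [List.flatMap_cons, rtrigListAct_append]
    refine ⟨fun f hf k hk => (h1 f hf).1 k (hk m List.mem_cons_self), ?_⟩
    rw [List.map_cons, List.prod_cons, ← ih2]
    exact h2

theorem list_prod_map_filter {M ι : Type} [CommMonoid M] (p : ι → Prop) [DecidablePred p]
    (f : ι → M) (L : List ι) :
    ((L.filter fun j => p j).map f).prod = (L.map fun j => if p j then f j else 1).prod := by
  induction L with
  | nil => rfl
  | cons a L ih => by_cases h : p a <;> simp [h, ih]

theorem rtrigListAct_pairsLex_diag {F : Type} [Field F] (q : F) {N r : ℕ} (u : Fin r → F)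
    {g : Fin r → Fin N} (hg : Function.Injective g) :
    rtrigListAct q u (pairsLex r) (Pi.single g 1) g =
      ∏ p ∈ Finset.univ.filter fun p : Fin r × Fin r => p.1 < p.2, (u p.1 - u p.2) := by
  have h := (rtrigListAct_flatMap_diag q u hg _ (List.pairwise_lt_finRange r)).2
  refine Eq.trans h ?_
  rw [Finset.prod_filter, Fintype.prod_prod_type]
  simp only [list_prod_map_filter, Fin.prod_univ_def]

theorem exists_swap_comp_eq_of_not_injective {r : ℕ} {α : Type} {f : Fin r → α}
    (hf : ¬ Function.Injective f) :
    ∃ τ : Equiv.Perm (Fin r), f ∘ τ = f ∧ Equiv.Perm.sign τ = -1 := by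
  simp only [Function.Injective, not_forall] at hf
  obtain ⟨a, b, hab, hne⟩ := hf
  refine ⟨Equiv.swap a b, ?_, Equiv.Perm.sign_swap hne⟩
  rw [← update_update_eq_comp_swap, ← hab, Function.update_eq_self, hab, Function.update_eq_self]

theorem prod_Rtrig_eq_smul_AqM {F : Type} [Field F] [CharZero F] {q : F} (hq : q ≠ 0) {N r : ℕ}
    {Pq : Equiv.Perm (Fin r) → Matrix (Fin r → Fin N) (Fin r → Fin N) F}
    (hPq : PqExt F q N r Pq) (u : Fin r → F)
    (hu : ∀ i i' : Fin r, i.val + 1 = i'.val → u i' = q⁻¹ ^ 2 * u i) :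
    ((pairsLex r).map fun p => big2 F p.1 p.2 (Rtrig F q N (u p.1) (u p.2))).prod
      = (∏ p ∈ Finset.univ.filter fun p : Fin r × Fin r => p.1 < p.2, (u p.1 - u p.2)) •
        AqM F Pq := by
  ext f g
  set c := ∏ p ∈ Finset.univ.filter fun p : Fin r × Fin r => p.1 < p.2, (u p.1 - u p.2)
  set Y := rtrigListAct q u (pairsLex r) (Pi.single g 1) with hYdef
  have hlhs : ((pairsLex r).map fun p =>
      big2 F p.1 p.2 (Rtrig F q N (u p.1) (u p.2))).prod f g = Y f := by
    rw [hYdef, ← prod_big2_Rtrig_mulVec, Matrix.mulVec_single_one]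
    · rfl
    · intro p hp
      simp only [pairsLex, List.mem_flatMap, List.mem_map, List.mem_filter] at hp
      obtain ⟨i, _, j, ⟨_, hij⟩, rfl⟩ := hp
      exact (of_decide_eq_true hij).ne
  have hanti : ∀ i i' : Fin r, i.val + 1 = i'.val → QAnti q i i' Y := fun i i' hi =>
    qAnti_rtrigListAct_pairsLex hq hi u (hu i i' hi) _
  have hz : ∀ n : ℤ, q ^ n ≠ 0 := fun n => zpow_ne_zero _ hq
  rw [hlhs, Matrix.smul_apply, AqM, Matrix.sum_apply]
  simp only [Matrix.smul_apply, hPq.apply_eq hq, smul_eq_mul]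
  by_cases hf : Function.Injective f
  · by_cases hex : ∃ σ : Equiv.Perm (Fin r), f ∘ σ = g
    · obtain ⟨σ, hσ⟩ := hex
      rw [Finset.sum_eq_single σ]
      · have hgi : Function.Injective g := hσ ▸ hf.comp σ.injective
        have hd : Y g = c := rtrigListAct_pairsLex_diag q u hgi
        have hw := QAnti.comp_perm hq hanti σ f
        have hsq : ((Equiv.Perm.sign σ : ℤ) : F) * ((Equiv.Perm.sign σ : ℤ) : F) = 1 := by
          rw [← Int.cast_mul, ← Units.val_mul, Int.units_mul_self]
          simp
        rw [hσ, hd] at hw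
        rw [if_pos hσ]
        have h1 := hz (wordInv f)
        have h2 := hz (wordInv g)
        calc Y f = q ^ (wordInv f : ℤ) * (((Equiv.Perm.sign σ : ℤ) : F) *
              (((Equiv.Perm.sign σ : ℤ) : F) * ((q ^ (wordInv f : ℤ))⁻¹ * Y f))) := by
              rw [← mul_assoc _ _ (_ * Y f), hsq, one_mul, mul_inv_cancel_left₀ h1]
          _ = _ := by rw [← hw]; ring
      · intro τ _ hne
        rw [if_neg, mul_zero]
        intro hτ
        refine hne (Equiv.ext fun x => hf ?_)
        exact congrFun (hτ.trans hσ.symm) x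
      · simp
    · have hY0 : Y f = 0 := by
        by_contra hne
        exact hex (exists_comp_perm_of_rtrigListAct_ne_zero q u _ g f hne)
      rw [hY0, Finset.sum_eq_zero, mul_zero]
      intro σ _
      rw [if_neg fun h => hex ⟨σ, h⟩, mul_zero]
  · obtain ⟨τ, hτ, hsign⟩ := exists_swap_comp_eq_of_not_injective hf
    have hw := QAnti.comp_perm hq hanti τ f
    rw [hτ, hsign] at hw
    have hY0 : Y f = 0 := by
      have h3 : (q ^ (wordInv f : ℤ))⁻¹ * Y f = 0 := by
        rw [← self_eq_neg (G := F)]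
        simpa using hw
      exact (mul_eq_zero.1 h3).resolve_left (inv_ne_zero (hz _))
    rw [hY0, eq_comm]
    refine mul_eq_zero_of_right _ ?_
    rw [← self_eq_neg (G := F), ← Finset.sum_neg_distrib]
    refine Fintype.sum_equiv (Equiv.mulLeft τ) _ _ fun σ => ?_
    rw [Equiv.coe_mulLeft, Equiv.Perm.sign_mul, hsign, Equiv.Perm.coe_mul, ← Function.comp_assoc,
      hτ]
    split_ifs <;> simp

set_option synthInstance.maxHeartbeats 1000000 in
/-- `R(1, q⁻², …, q^{-2r+2}) = ∏_{0 ≤ i < j ≤ r-1} (q^{-2i} - q^{-2j}) · A^q_r`,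
where `R(u₁,…,u_r) = ∏_{i<j} R_ij(u_i,u_j)` (lexicographic order of the pairs) and
`A^q_r = Σ_σ sgn(σ) P^q_σ` is the q-antisymmetrizer, `P^q_σ` being determined by
reduced decompositions of `σ`. -/
theorem stmt17 (N r : ℕ)
    (Pq : Equiv.Perm (Fin r) → Matrix (Fin r → Fin N) (Fin r → Fin N) FF)
    (hPq : PqExt FF qq N r Pq) :
    ((pairsLex r).map fun p =>
        big2 FF p.1 p.2
          (Rtrig FF qq N (qq ^ (-2 * (p.1.val : ℤ))) (qq ^ (-2 * (p.2.val : ℤ))))).prod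
      = (∏ p ∈ Finset.univ.filter fun p : Fin r × Fin r => p.1 < p.2,
            (qq ^ (-2 * (p.1.val : ℤ)) - qq ^ (-2 * (p.2.val : ℤ)))) • AqM FF Pq := by

  have hq : qq ≠ 0 := RatFunc.X_ne_zero
  refine prod_Rtrig_eq_smul_AqM hq hPq (fun i => qq ^ (-2 * (i.val : ℤ))) fun i i' hi => ?_
  rw [← hi, Nat.cast_succ, mul_add, add_comm, zpow_add₀ hq]
  simp [zpow_neg]
end
end
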